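/- arXiv:2505.06927 — 2 statements merged into one kernel-verified Lean document; each statement's English description precedes it below -/
import Mathlib

section
/- With probability at least 1 − δ over the draw of the i.i.d. training sample S ∼ D^n, the risk of the full-sample predictor is bounded by the k-fold cross-validation error plus a stability term: R(S) ≤ R_CV(S) + sqrt((M² + 6·M·k·μ_h) / (2·k·δ)), for any δ ∈ (0, 1). -/
open MeasureTheory

/-- Index of the `r`-th element of the `j`-th consecutive fold of size `m`
in a sample of size `n = k * m`. -/
def foldIdx (k m : ℕ) (j : Fin k) (r : Fin m) : Fin (k * m) :=
  ⟨(j : ℕ) * m + (r : ℕ), by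
    have h1 : (j : ℕ) + 1 ≤ k := j.2
    calc (j : ℕ) * m + (r : ℕ) < (j : ℕ) * m + m := by omega
      _ = ((j : ℕ) + 1) * m := by ring
      _ ≤ k * m := Nat.mul_le_mul_right m h1⟩

/-- The sample `S` of size `n = k * m` with the `j`-th consecutive fold
(of size `m`) removed. -/
def removeFold {Z : Type*} (k m : ℕ) (j : Fin k) (S : Fin (k * m) → Z) :
    Fin (k * m - m) → Z := fun i =>
  S ⟨if (i : ℕ) < (j : ℕ) * m then (i : ℕ) else (i : ℕ) + m, by
      have h1 : (i : ℕ) < k * m - m := i.2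
      have h2 : m ≤ k * m := Nat.le_mul_of_pos_left m j.pos
      split <;> omega⟩

open ProbabilityTheory in
/-- Precomposition with an injection preserves the i.i.d. product measure. -/
lemma cvaux_mp_comp {W A K : Type*} [MeasurableSpace W] [Fintype A] [Fintype K]
    (P : Measure W) [IsProbabilityMeasure P] (e : A → K) (he : Function.Injective e) :
    MeasurePreserving (fun (T : K → W) (a : A) => T (e a))
      (Measure.pi fun _ : K => P) (Measure.pi fun _ : A => P) := by
  refine ⟨by fun_prop, ?_⟩
  have h1 : iIndepFun (fun (i : K) (T : K → W) => T i) (Measure.pi fun _ : K => P) :=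
    iIndepFun_pi (X := fun _ w => w) (fun i => aemeasurable_id)
  have h2 := h1.precomp he
  rw [iIndepFun_iff_map_fun_eq_pi_map (fun i => (measurable_pi_apply (e i)).aemeasurable)] at h2
  rw [h2]
  congr 1
  funext a
  exact (measurePreserving_eval (fun _ : K => P) (e a)).map_eq

lemma cvaux_mp_one {W A K : Type*} [MeasurableSpace W] [Fintype A] [Fintype K]
    (P : Measure W) [IsProbabilityMeasure P] (a : A → K) (ha : Function.Injective a)
    (b : K) (hb : ∀ i, a i ≠ b) :
    MeasurePreserving (fun (T : K → W) => ((fun i => T (a i)), T b))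
      (Measure.pi fun _ : K => P) ((Measure.pi fun _ : A => P).prod P) := by
  have h1 := cvaux_mp_comp P (Sum.elim a (fun _ : Unit => b))
    (ha.sumElim (Function.injective_of_subsingleton _) (fun i _ => hb i))
  have h2 := measurePreserving_sumPiEquivProdPi (fun _ : A ⊕ Unit => P)
  have h3 := (MeasurePreserving.id (Measure.pi fun _ : A => P)).prod
    (measurePreserving_funUnique P Unit)
  exact h3.comp (h2.comp h1)

lemma cvaux_mp_two {W A : Type*} [MeasurableSpace W] [Fintype A]
    (P : Measure W) [IsProbabilityMeasure P] :
    MeasurePreserving (fun (T : A ⊕ Fin 2 → W) =>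
        ((fun i => T (Sum.inl i)), (T (Sum.inr 0), T (Sum.inr 1))))
      (Measure.pi fun _ : A ⊕ Fin 2 => P) ((Measure.pi fun _ : A => P).prod (P.prod P)) := by
  have h2 := measurePreserving_sumPiEquivProdPi (fun _ : A ⊕ Fin 2 => P)
  have h3 := (MeasurePreserving.id (Measure.pi fun _ : A => P)).prod
    (measurePreserving_finTwoArrow P)
  exact h3.comp h2

lemma cvaux_integral {α β : Type*} [MeasurableSpace α] [MeasurableSpace β] {μ : Measure α}
    {ν : Measure β} {f : α → β} (hf : MeasurePreserving f μ ν) (g : β → ℝ) (hg : Measurable g) :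
    ∫ x, g (f x) ∂μ = ∫ y, g y ∂ν := by
  rw [← hf.map_eq, integral_map hf.measurable.aemeasurable hg.aestronglyMeasurable]

lemma cvaux_int {α : Type*} [MeasurableSpace α] {μ : Measure α} [IsFiniteMeasure μ]
    {f : α → ℝ} (hf : Measurable f) (C : ℝ) (h : ∀ x, |f x| ≤ C) : Integrable f μ :=
  Integrable.of_bound hf.aestronglyMeasurable C (Filter.Eventually.of_forall h)

lemma cvaux_three {α : Type*} [MeasurableSpace α] {μ : Measure α}
    {X1 X2 d1 d2 d3 : α → ℝ} {c ε : ℝ} (hc : 0 ≤ c)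
    (hX1 : Integrable X1 μ) (hX2 : Integrable X2 μ)
    (h1 : Integrable d1 μ) (h2 : Integrable d2 μ) (h3 : Integrable d3 μ)
    (e1 : ∫ x, |d1 x| ∂μ ≤ ε) (e2 : ∫ x, |d2 x| ∂μ ≤ ε) (e3 : ∫ x, |d3 x| ∂μ ≤ ε)
    (h : ∀ x, ∃ p q r : ℝ, |p| ≤ c ∧ |q| ≤ c ∧ |r| ≤ c ∧
      X1 x - X2 x = p * d1 x + q * d2 x + r * d3 x) :
    ∫ x, X1 x ∂μ ≤ ∫ x, X2 x ∂μ + 3 * c * ε := by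
  have key : ∫ x, X1 x ∂μ ≤ ∫ x, (X2 x + c * (|d1 x| + |d2 x| + |d3 x|)) ∂μ := by
    refine integral_mono hX1 (hX2.add (((h1.abs.add h2.abs).add h3.abs).const_mul c)) ?_
    intro x
    obtain ⟨p, q, r, hp, hq, hr, e⟩ := h x
    have aux : ∀ a b : ℝ, |a| ≤ c → a * b ≤ c * |b| := fun a b hab =>
      (le_abs_self _).trans (by rw [abs_mul]; gcongr)
    have := aux p (d1 x) hp
    have := aux q (d2 x) hq
    have := aux r (d3 x) hr
    simp only
    linarith
  have e : ∫ x, (X2 x + c * (|d1 x| + |d2 x| + |d3 x|)) ∂μ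
      = ∫ x, X2 x ∂μ + c * (∫ x, |d1 x| ∂μ + ∫ x, |d2 x| ∂μ + ∫ x, |d3 x| ∂μ) := by
    have h12 : Integrable (fun x => |d1 x| + |d2 x|) μ := h1.abs.add h2.abs
    have h123 : Integrable (fun x => |d1 x| + |d2 x| + |d3 x|) μ := h12.add h3.abs
    rw [integral_add hX2 (h123.const_mul c), integral_const_mul,
      integral_add h12 h3.abs, integral_add h1.abs h2.abs]
  rw [e] at key
  have : c * (∫ x, |d1 x| ∂μ + ∫ x, |d2 x| ∂μ + ∫ x, |d3 x| ∂μ) ≤ c * (ε + ε + ε) := by gcongr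
  linarith

section cvaux

variable {W : Type*} [MeasurableSpace W] (P : Measure W) [IsProbabilityMeasure P]
  {k : ℕ} (c μ : ℝ)
  (F : (Fin k → W) → W → ℝ) (G : Fin k → (Fin k → W) → W → ℝ)

lemma cvaux_stab
    (hF : Measurable fun p : (Fin k → W) × W => F p.1 p.2)
    (hG : ∀ j, Measurable fun p : (Fin k → W) × W => G j p.1 p.2)
    (hFc : ∀ S w, |F S w| ≤ c) (hGc : ∀ j S w, |G j S w| ≤ c)
    (hst : ∀ j, ∫ S, ∫ w, |G j S w - F S w| ∂P ∂(Measure.pi fun _ : Fin k => P) ≤ μ)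
    {K : Type*} [Fintype K] (j : Fin k) (a : Fin k → K) (ha : Function.Injective a)
    (b : K) (hb : ∀ i, a i ≠ b) :
    ∫ T, |G j (fun i => T (a i)) (T b) - F (fun i => T (a i)) (T b)|
      ∂(Measure.pi fun _ : K => P) ≤ μ := by
  have hm : Measurable fun p : (Fin k → W) × W => |G j p.1 p.2 - F p.1 p.2| :=
    _root_.continuous_abs.measurable.comp ((hG j).sub hF)
  have h := cvaux_integral (cvaux_mp_one P a ha b hb) _ hm
  refine le_trans (le_of_eq h) (le_trans (le_of_eq ?_) (hst j))
  rw [integral_prod]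
  refine cvaux_int hm (c + c) (fun p => ?_)
  rw [abs_abs]
  exact (abs_sub _ _).trans (add_le_add (hGc _ _ _) (hFc _ _))

lemma cvaux_A (hc : 0 ≤ c)
    (hF : Measurable fun p : (Fin k → W) × W => F p.1 p.2)
    (hG : ∀ j, Measurable fun p : (Fin k → W) × W => G j p.1 p.2)
    (hFc : ∀ S w, |F S w| ≤ c) (hGc : ∀ j S w, |G j S w| ≤ c)
    (hdep : ∀ j S S', (∀ i, i ≠ j → S i = S' i) → G j S = G j S')
    (hst : ∀ j, ∫ S, ∫ w, |G j S w - F S w| ∂P ∂(Measure.pi fun _ : Fin k => P) ≤ μ)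
    (i : Fin k) :
    ∫ T : Fin k ⊕ Fin 2 → W, F (fun l => T (.inl l)) (T (.inr 0)) * F (fun l => T (.inl l)) (T (.inr 1))
      ∂(Measure.pi fun _ => P) ≤
    ∫ T : Fin k ⊕ Fin 2 → W, F (fun l => T (.inl l)) (T (.inr 0)) * G i (fun l => T (.inl l)) (T (.inl i))
      ∂(Measure.pi fun _ => P) + 3 * c * μ := by
  classical
  have mF : ∀ (a : Fin k → Fin k ⊕ Fin 2) b, Measurable fun T : Fin k ⊕ Fin 2 → W =>
      F (fun l => T (a l)) (T b) := fun a b => hF.comp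
        (f := fun T : Fin k ⊕ Fin 2 → W => ((fun l => T (a l)), T b)) (by fun_prop)
  have mG : ∀ j (a : Fin k → Fin k ⊕ Fin 2) b, Measurable fun T : Fin k ⊕ Fin 2 → W =>
      G j (fun l => T (a l)) (T b) := fun j a b => (hG j).comp
        (f := fun T : Fin k ⊕ Fin 2 → W => ((fun l => T (a l)), T b)) (by fun_prop)
  have bm : ∀ x y : ℝ, |x| ≤ c → |y| ≤ c → |x * y| ≤ c * c := fun x y hx hy => by
    rw [abs_mul]; gcongr
  have bs : ∀ x y : ℝ, |x| ≤ c → |y| ≤ c → |x - y| ≤ c + c := fun x y hx hy =>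
    (abs_sub _ _).trans (add_le_add hx hy)
  set σ : Equiv.Perm (Fin k ⊕ Fin 2) := Equiv.swap (.inl i) (.inr 1) with hσ
  have s1 : σ (.inl i) = .inr 1 := Equiv.swap_apply_left _ _
  have s2 : σ (.inr 0) = .inr 0 := Equiv.swap_apply_of_ne_of_ne (by simp) (by simp)
  have s3 : ∀ l, l ≠ i → σ (.inl l) = .inl l := fun l hl =>
    Equiv.swap_apply_of_ne_of_ne (by simpa using hl) (by simp)
  have inj : Function.Injective fun l : Fin k => σ (.inl l) :=
    σ.injective.comp Sum.inl_injective
  have stab := cvaux_stab P c μ F G hF hG hFc hGc hst (K := Fin k ⊕ Fin 2)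
  have rel := cvaux_integral (cvaux_mp_comp P σ σ.injective) _
    ((mF Sum.inl (.inr 0)).mul (mG i Sum.inl (.inl i)))
  refine le_trans ?_ (le_of_eq (congrArg (· + 3 * c * μ) rel))
  refine cvaux_three hc
    (d1 := fun T => G i (fun l => T (.inl l)) (T (.inr 1)) - F (fun l => T (.inl l)) (T (.inr 1)))
    (d2 := fun T => G i (fun l => T (.inl l)) (T (.inr 0)) - F (fun l => T (.inl l)) (T (.inr 0)))
    (d3 := fun T => G i (fun l => T (σ (.inl l))) (T (.inr 0)) - F (fun l => T (σ (.inl l))) (T (.inr 0)))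
    (cvaux_int ((mF _ _).mul (mF _ _)) (c * c) fun T => bm _ _ (hFc _ _) (hFc _ _))
    (cvaux_int ((mF (fun l => σ (.inl l)) (σ (.inr 0))).mul
      (mG i (fun l => σ (.inl l)) (σ (.inl i)))) (c * c) fun T => bm _ _ (hFc _ _) (hGc _ _ _))
    (cvaux_int ((mG _ _ _).sub (mF _ _)) (c + c) fun T => bs _ _ (hGc _ _ _) (hFc _ _))
    (cvaux_int ((mG _ _ _).sub (mF _ _)) (c + c) fun T => bs _ _ (hGc _ _ _) (hFc _ _))
    (cvaux_int ((mG _ _ _).sub (mF _ _)) (c + c) fun T => bs _ _ (hGc _ _ _) (hFc _ _))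
    (stab i _ Sum.inl_injective _ (by simp))
    (stab i _ Sum.inl_injective _ (by simp))
    (stab i _ inj _ (fun l => by rw [← s2]; simp)) ?_
  intro T
  have e : G i (fun l => T (σ (.inl l))) = G i (fun l => T (.inl l)) :=
    hdep _ _ _ (fun l hl => by rw [s3 l hl])
  refine ⟨-F (fun l => T (.inl l)) (T (.inr 0)), -G i (fun l => T (.inl l)) (T (.inr 1)),
    G i (fun l => T (.inl l)) (T (.inr 1)), by rw [abs_neg]; exact hFc _ _,
    by rw [abs_neg]; exact hGc _ _ _, hGc _ _ _, ?_⟩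
  simp only [Pi.mul_apply, s1, s2, e]
  ring

lemma cvaux_C (hc : 0 ≤ c)
    (hF : Measurable fun p : (Fin k → W) × W => F p.1 p.2)
    (hG : ∀ j, Measurable fun p : (Fin k → W) × W => G j p.1 p.2)
    (hFc : ∀ S w, |F S w| ≤ c) (hGc : ∀ j S w, |G j S w| ≤ c)
    (hdep : ∀ j S S', (∀ i, i ≠ j → S i = S' i) → G j S = G j S')
    (hsym : ∀ i j S, G i (fun l => S (Equiv.swap i j l)) = G j S)
    (hst : ∀ j, ∫ S, ∫ w, |G j S w - F S w| ∂P ∂(Measure.pi fun _ : Fin k => P) ≤ μ)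
    (i j : Fin k) (hij : i ≠ j) :
    ∫ T : Fin k ⊕ Fin 2 → W, G i (fun l => T (.inl l)) (T (.inl i)) * G j (fun l => T (.inl l)) (T (.inl j))
      ∂(Measure.pi fun _ => P) ≤
    ∫ T : Fin k ⊕ Fin 2 → W, F (fun l => T (.inl l)) (T (.inr 1)) * G j (fun l => T (.inl l)) (T (.inl j))
      ∂(Measure.pi fun _ => P) + 3 * c * μ := by
  classical
  have mF : ∀ (a : Fin k → Fin k ⊕ Fin 2) b, Measurable fun T : Fin k ⊕ Fin 2 → W =>
      F (fun l => T (a l)) (T b) := fun a b => hF.comp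
        (f := fun T : Fin k ⊕ Fin 2 → W => ((fun l => T (a l)), T b)) (by fun_prop)
  have mG : ∀ j (a : Fin k → Fin k ⊕ Fin 2) b, Measurable fun T : Fin k ⊕ Fin 2 → W =>
      G j (fun l => T (a l)) (T b) := fun j a b => (hG j).comp
        (f := fun T : Fin k ⊕ Fin 2 → W => ((fun l => T (a l)), T b)) (by fun_prop)
  have bm : ∀ x y : ℝ, |x| ≤ c → |y| ≤ c → |x * y| ≤ c * c := fun x y hx hy => by
    rw [abs_mul]; gcongr
  have bs : ∀ x y : ℝ, |x| ≤ c → |y| ≤ c → |x - y| ≤ c + c := fun x y hx hy =>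
    (abs_sub _ _).trans (add_le_add hx hy)
  set σ : Equiv.Perm (Fin k ⊕ Fin 2) := Equiv.swap (.inl i) (.inr 1) with hσ
  have s1 : σ (.inl i) = .inr 1 := Equiv.swap_apply_left _ _
  have s3 : ∀ l, l ≠ i → σ (.inl l) = .inl l := fun l hl =>
    Equiv.swap_apply_of_ne_of_ne (by simpa using hl) (by simp)
  let a1 : Fin k → Fin k ⊕ Fin 2 := fun l =>
    if l = i then .inr 1 else if l = j then .inl i else .inl l
  have inj : Function.Injective a1 := by
    intro l l' h
    simp only [a1] at h
    split_ifs at h <;> simp_all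
  have hb : ∀ l, a1 l ≠ .inl j := by
    intro l
    simp only [a1]
    split_ifs <;> simp_all
  have stab := cvaux_stab P c μ F G hF hG hFc hGc hst (K := Fin k ⊕ Fin 2)
  have rel := cvaux_integral (cvaux_mp_comp P σ σ.injective) _
    ((mG i Sum.inl (.inl i)).mul (mG j Sum.inl (.inl j)))
  refine le_trans (le_of_eq rel.symm) ?_
  refine cvaux_three hc
    (d1 := fun T => G j (fun l => T (a1 l)) (T (.inl j)) - F (fun l => T (a1 l)) (T (.inl j)))
    (d2 := fun T => G i (fun l => T (a1 l)) (T (.inl j)) - F (fun l => T (a1 l)) (T (.inl j)))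
    (d3 := fun T => G i (fun l => T (.inl l)) (T (.inr 1)) - F (fun l => T (.inl l)) (T (.inr 1)))
    (cvaux_int ((mG i (fun l => σ (.inl l)) (σ (.inl i))).mul
      (mG j (fun l => σ (.inl l)) (σ (.inl j)))) (c * c) fun T => bm _ _ (hGc _ _ _) (hGc _ _ _))
    (cvaux_int ((mF _ _).mul (mG _ _ _)) (c * c) fun T => bm _ _ (hFc _ _) (hGc _ _ _))
    (cvaux_int ((mG _ _ _).sub (mF _ _)) (c + c) fun T => bs _ _ (hGc _ _ _) (hFc _ _))
    (cvaux_int ((mG _ _ _).sub (mF _ _)) (c + c) fun T => bs _ _ (hGc _ _ _) (hFc _ _))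
    (cvaux_int ((mG _ _ _).sub (mF _ _)) (c + c) fun T => bs _ _ (hGc _ _ _) (hFc _ _))
    (stab j _ inj _ hb)
    (stab i _ inj _ hb)
    (stab i _ Sum.inl_injective _ (by simp)) ?_
  intro T
  have e1 : G i (fun l => T (σ (.inl l))) = G i (fun l => T (.inl l)) :=
    hdep _ _ _ (fun l hl => by rw [s3 l hl])
  have e2 : G j (fun l => T (σ (.inl l))) = G j (fun l => T (a1 l)) :=
    hdep _ _ _ (fun l hl => by
      by_cases h : l = i
      · subst h; simp [a1, s1]
      · rw [s3 l h]; simp [a1, h, hl])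
  have e3 : G i (fun l => T (a1 l)) = G j (fun l => T (.inl l)) := by
    rw [← hsym i j]
    refine hdep _ _ _ (fun l hl => ?_)
    by_cases h : l = j
    · subst h; simp [a1, hl]
    · rw [Equiv.swap_apply_of_ne_of_ne hl h]; simp [a1, h, hl]
  refine ⟨G i (fun l => T (.inl l)) (T (.inr 1)), -G i (fun l => T (.inl l)) (T (.inr 1)),
    G j (fun l => T (.inl l)) (T (.inl j)), hGc _ _ _,
    by rw [abs_neg]; exact hGc _ _ _, hGc _ _ _, ?_⟩
  simp only [Pi.mul_apply, s1, s3 j hij.symm, e1, e2, e3]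
  ring

lemma cvaux_moment (hk : 0 < k) (hc : 0 ≤ c) (hμ : 0 ≤ μ)
    (hF : Measurable fun p : (Fin k → W) × W => F p.1 p.2)
    (hG : ∀ j, Measurable fun p : (Fin k → W) × W => G j p.1 p.2)
    (hFc : ∀ S w, |F S w| ≤ c) (hGc : ∀ j S w, |G j S w| ≤ c)
    (hdep : ∀ j S S', (∀ i, i ≠ j → S i = S' i) → G j S = G j S')
    (hsym : ∀ i j S, G i (fun l => S (Equiv.swap i j l)) = G j S)
    (hst : ∀ j, ∫ S, ∫ w, |G j S w - F S w| ∂P ∂(Measure.pi fun _ : Fin k => P) ≤ μ) :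
    ∫ S, ((∫ w, F S w ∂P) - (1 / (k : ℝ)) * ∑ j, G j S (S j)) ^ 2
      ∂(Measure.pi fun _ : Fin k => P) ≤ 2 * c ^ 2 / k + 6 * c * μ := by
  have hk' : (0 : ℝ) < k := by exact_mod_cast hk
  have mF : ∀ (a : Fin k → Fin k ⊕ Fin 2) b, Measurable fun T : Fin k ⊕ Fin 2 → W =>
      F (fun l => T (a l)) (T b) := fun a b => hF.comp
        (f := fun T : Fin k ⊕ Fin 2 → W => ((fun l => T (a l)), T b)) (by fun_prop)
  have mG : ∀ j (a : Fin k → Fin k ⊕ Fin 2) b, Measurable fun T : Fin k ⊕ Fin 2 → W =>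
      G j (fun l => T (a l)) (T b) := fun j a b => (hG j).comp
        (f := fun T : Fin k ⊕ Fin 2 → W => ((fun l => T (a l)), T b)) (by fun_prop)
  have bm : ∀ x y : ℝ, |x| ≤ c → |y| ≤ c → |x * y| ≤ c * c := fun x y hx hy => by
    rw [abs_mul]; gcongr
  have mGd : ∀ j, Measurable fun S : Fin k → W => G j S (S j) := fun j => (hG j).comp
    (f := fun S : Fin k → W => (S, S j)) (by fun_prop)
  have mC : Measurable fun S : Fin k → W => (1 / (k : ℝ)) * ∑ j, G j S (S j) :=
    (Finset.measurable_sum _ fun j _ => mGd j).const_mul _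
  have bC : ∀ S : Fin k → W, |(1 / (k : ℝ)) * ∑ j, G j S (S j)| ≤ c := by
    intro S
    rw [abs_mul, abs_of_pos (by positivity : (0 : ℝ) < 1 / k)]
    have : |∑ j, G j S (S j)| ≤ k * c := by
      refine (Finset.abs_sum_le_sum_abs _ _).trans ?_
      refine (Finset.sum_le_sum fun j _ => hGc j S (S j)).trans ?_
      simp
    calc 1 / (k : ℝ) * |∑ j, G j S (S j)| ≤ 1 / k * (k * c) := by gcongr
      _ = c := by field_simp
  have h0 : ∫ S, ((∫ w, F S w ∂P) - (1 / (k : ℝ)) * ∑ j, G j S (S j)) ^ 2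
      ∂(Measure.pi fun _ : Fin k => P) =
      ∫ T : Fin k ⊕ Fin 2 → W,
        (F (fun l => T (.inl l)) (T (.inr 0)) - (1 / (k : ℝ)) * ∑ j, G j (fun l => T (.inl l)) (T (.inl j)))
        * (F (fun l => T (.inl l)) (T (.inr 1)) - (1 / (k : ℝ)) * ∑ j, G j (fun l => T (.inl l)) (T (.inl j)))
        ∂(Measure.pi fun _ => P) := by
    have mm : Measurable fun q : (Fin k → W) × (W × W) =>
        (F q.1 q.2.1 - (1 / (k : ℝ)) * ∑ j, G j q.1 (q.1 j)) *
        (F q.1 q.2.2 - (1 / (k : ℝ)) * ∑ j, G j q.1 (q.1 j)) := by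
      have m1 : Measurable fun q : (Fin k → W) × (W × W) => F q.1 q.2.1 :=
        hF.comp (f := fun q : (Fin k → W) × (W × W) => (q.1, q.2.1)) (by fun_prop)
      have m2 : Measurable fun q : (Fin k → W) × (W × W) => F q.1 q.2.2 :=
        hF.comp (f := fun q : (Fin k → W) × (W × W) => (q.1, q.2.2)) (by fun_prop)
      have m3 := mC.comp (measurable_fst : Measurable fun q : (Fin k → W) × (W × W) => q.1)
      exact (m1.sub m3).mul (m2.sub m3)
    have h := cvaux_integral (cvaux_mp_two (A := Fin k) P) _ mm
    refine Eq.trans ?_ h.symm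
    rw [integral_prod]
    · refine integral_congr_ae (Filter.Eventually.of_forall fun S => ?_)
      simp only
      rw [integral_prod_mul (μ := P) (ν := P)
        (fun w => F S w - (1 / (k : ℝ)) * ∑ j, G j S (S j))
        (fun w => F S w - (1 / (k : ℝ)) * ∑ j, G j S (S j))]
      have hi : Integrable (fun w => F S w) P :=
        cvaux_int (hF.comp (f := fun w => (S, w)) (by fun_prop)) c (fun w => hFc S w)
      rw [integral_sub hi (integrable_const _)]
      simp [sq]
    · refine cvaux_int mm ((c + c) * (c + c)) fun q => ?_
      rw [abs_mul]
      gcongr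
      · exact (abs_sub _ _).trans (add_le_add (hFc _ _) (bC _))
      · exact (abs_sub _ _).trans (add_le_add (hFc _ _) (bC _))
  have iA : Integrable (fun T : Fin k ⊕ Fin 2 → W => F (fun l => T (.inl l)) (T (.inr 0)) *
      F (fun l => T (.inl l)) (T (.inr 1))) (Measure.pi fun _ => P) :=
    cvaux_int ((mF _ _).mul (mF _ _)) (c * c) fun T => bm _ _ (hFc _ _) (hFc _ _)
  have iB : ∀ (s : Fin 2) i, Integrable (fun T : Fin k ⊕ Fin 2 → W => F (fun l => T (.inl l)) (T (.inr s)) *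
      G i (fun l => T (.inl l)) (T (.inl i))) (Measure.pi fun _ => P) := fun s i =>
    cvaux_int ((mF _ _).mul (mG _ _ _)) (c * c) fun T => bm _ _ (hFc _ _) (hGc _ _ _)
  have iC : ∀ i j, Integrable (fun T : Fin k ⊕ Fin 2 → W => G i (fun l => T (.inl l)) (T (.inl i)) *
      G j (fun l => T (.inl l)) (T (.inl j))) (Measure.pi fun _ => P) := fun i j =>
    cvaux_int ((mG _ _ _).mul (mG _ _ _)) (c * c) fun T => bm _ _ (hGc _ _ _) (hGc _ _ _)
  have iAll : ∀ i j, Integrable (fun T : Fin k ⊕ Fin 2 → W =>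
      F (fun l => T (.inl l)) (T (.inr 0)) * F (fun l => T (.inl l)) (T (.inr 1))
      - F (fun l => T (.inl l)) (T (.inr 0)) * G i (fun l => T (.inl l)) (T (.inl i))
      + (G i (fun l => T (.inl l)) (T (.inl i)) * G j (fun l => T (.inl l)) (T (.inl j))
      - F (fun l => T (.inl l)) (T (.inr 1)) * G j (fun l => T (.inl l)) (T (.inl j))))
      (Measure.pi fun _ => P) := fun i j =>
    (iA.sub (iB 0 i)).add ((iC i j).sub (iB 1 j))
  have hterm : ∀ i j, ∫ T : Fin k ⊕ Fin 2 → W,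
      (F (fun l => T (.inl l)) (T (.inr 0)) * F (fun l => T (.inl l)) (T (.inr 1))
      - F (fun l => T (.inl l)) (T (.inr 0)) * G i (fun l => T (.inl l)) (T (.inl i))
      + (G i (fun l => T (.inl l)) (T (.inl i)) * G j (fun l => T (.inl l)) (T (.inl j))
      - F (fun l => T (.inl l)) (T (.inr 1)) * G j (fun l => T (.inl l)) (T (.inl j))))
      ∂(Measure.pi fun _ => P) ≤ 6 * c * μ + if i = j then 2 * c ^ 2 else 0 := by
    intro i j
    have ha := cvaux_A P c μ F G hc hF hG hFc hGc hdep hst i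
    have e := integral_add (iA.sub (iB 0 i)) ((iC i j).sub (iB 1 j))
    simp only [Pi.sub_apply] at e
    rw [e, integral_sub iA (iB 0 i), integral_sub (iC i j) (iB 1 j)]
    split_ifs with hij
    · have b1 := norm_integral_le_of_norm_le_const (μ := Measure.pi fun _ : Fin k ⊕ Fin 2 => P)
        (C := c * c) (f := fun T : Fin k ⊕ Fin 2 → W => G i (fun l => T (.inl l)) (T (.inl i)) *
          G j (fun l => T (.inl l)) (T (.inl j)))
        (Filter.Eventually.of_forall fun T => bm _ _ (hGc _ _ _) (hGc _ _ _))
      have b2 := norm_integral_le_of_norm_le_const (μ := Measure.pi fun _ : Fin k ⊕ Fin 2 => P)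
        (C := c * c) (f := fun T : Fin k ⊕ Fin 2 → W => F (fun l => T (.inl l)) (T (.inr 1)) *
          G j (fun l => T (.inl l)) (T (.inl j)))
        (Filter.Eventually.of_forall fun T => bm _ _ (hFc _ _) (hGc _ _ _))
      simp only [probReal_univ, mul_one, Real.norm_eq_abs] at b1 b2
      have b1' := (abs_le.1 b1).2
      have b2' := (abs_le.1 b2).1
      have : 0 ≤ c * μ := mul_nonneg hc hμ
      linarith
    · have hcc := cvaux_C P c μ F G hc hF hG hFc hGc hdep hsym hst i j hij
      linarith
  rw [h0]
  have hpt : ∀ T : Fin k ⊕ Fin 2 → W,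
      (F (fun l => T (.inl l)) (T (.inr 0)) - (1 / (k : ℝ)) * ∑ j, G j (fun l => T (.inl l)) (T (.inl j)))
        * (F (fun l => T (.inl l)) (T (.inr 1)) - (1 / (k : ℝ)) * ∑ j, G j (fun l => T (.inl l)) (T (.inl j)))
      = (1 / (k : ℝ) ^ 2) * ∑ i, ∑ j,
      (F (fun l => T (.inl l)) (T (.inr 0)) * F (fun l => T (.inl l)) (T (.inr 1))
      - F (fun l => T (.inl l)) (T (.inr 0)) * G i (fun l => T (.inl l)) (T (.inl i))
      + (G i (fun l => T (.inl l)) (T (.inl i)) * G j (fun l => T (.inl l)) (T (.inl j))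
      - F (fun l => T (.inl l)) (T (.inr 1)) * G j (fun l => T (.inl l)) (T (.inl j)))) := by
    intro T
    simp only [Finset.sum_add_distrib, Finset.sum_sub_distrib, ← Finset.mul_sum,
      ← Finset.sum_mul, Finset.sum_const, Finset.card_univ, Fintype.card_fin, nsmul_eq_mul]
    field_simp
    ring
  simp_rw [hpt]
  rw [integral_const_mul, integral_finsetSum _ fun i _ => integrable_finsetSum _ fun j _ => iAll i j]
  simp_rw [integral_finsetSum _ fun j _ => iAll _ j]
  calc _ ≤ 1 / (k : ℝ) ^ 2 * ∑ i : Fin k, ∑ j : Fin k, (6 * c * μ + if i = j then 2 * c ^ 2 else 0) := by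
        gcongr with i _ j _
        exact hterm i j
    _ = _ := by
        simp only [Finset.sum_add_distrib, Finset.sum_ite_eq, Finset.mem_univ, if_true,
          Finset.sum_const, Finset.card_univ, Fintype.card_fin, nsmul_eq_mul]
        field_simp
        ring

end cvaux

/-- Glue `k` blocks of size `m` into one sample of size `k * m`. -/
def cvauxGlue {Z : Type*} (k m : ℕ) (T : Fin k → Fin m → Z) : Fin (k * m) → Z :=
  fun i => T i.divNat i.modNat

lemma cvaux_div (k m : ℕ) (j : Fin k) (r : Fin m) :
    (foldIdx k m j r).divNat = j ∧ (foldIdx k m j r).modNat = r := by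
  have hm : 0 < m := r.pos
  have h1 : (j : ℕ) * m + r = r + m * j := by ring
  constructor
  · ext
    simp only [Fin.coe_divNat, foldIdx]
    rw [h1, Nat.add_mul_div_left _ _ hm, Nat.div_eq_of_lt r.2, zero_add]
  · ext
    simp only [Fin.coe_modNat, foldIdx]
    rw [h1, Nat.add_mul_mod_self_left, Nat.mod_eq_of_lt r.2]

lemma cvaux_glue_fold {Z : Type*} (k m : ℕ) (T : Fin k → Fin m → Z) (j : Fin k) (r : Fin m) :
    cvauxGlue k m T (foldIdx k m j r) = T j r := by
  simp only [cvauxGlue, cvaux_div]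

lemma cvaux_fold_div (k m : ℕ) (i : Fin (k * m)) : foldIdx k m i.divNat i.modNat = i := by
  ext
  simp only [foldIdx, Fin.coe_divNat, Fin.coe_modNat]
  rw [mul_comm]
  exact Nat.div_add_mod _ _

/-- Indexing equivalence. -/
def cvauxEquiv (k m : ℕ) : Fin k × Fin m ≃ Fin (k * m) where
  toFun p := foldIdx k m p.1 p.2
  invFun i := (i.divNat, i.modNat)
  left_inv p := Prod.ext (cvaux_div k m p.1 p.2).1 (cvaux_div k m p.1 p.2).2
  right_inv i := cvaux_fold_div k m i

lemma cvaux_mp_glue {Z : Type*} [MeasurableSpace Z] (D : Measure Z) [IsProbabilityMeasure D]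
    (k m : ℕ) :
    MeasurePreserving (cvauxGlue (Z := Z) k m)
      (Measure.pi fun _ : Fin k => Measure.pi fun _ : Fin m => D)
      (Measure.pi fun _ : Fin (k * m) => D) := by
  have hmeas : Measurable (cvauxGlue (Z := Z) k m) := by
    unfold cvauxGlue
    fun_prop
  refine ⟨hmeas, (Measure.pi_eq fun s hs => ?_).symm⟩
  rw [Measure.map_apply hmeas (MeasurableSet.univ_pi hs)]
  have : cvauxGlue (Z := Z) k m ⁻¹' Set.univ.pi s =
      Set.univ.pi fun j => Set.univ.pi fun r => s (foldIdx k m j r) := by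
    ext T
    simp only [Set.mem_preimage, Set.mem_univ_pi]
    constructor
    · intro h j r
      have := h (foldIdx k m j r)
      rwa [cvaux_glue_fold] at this
    · intro h i
      have := h i.divNat i.modNat
      rwa [cvaux_fold_div] at this
  rw [this, Measure.pi_pi]
  simp_rw [Measure.pi_pi]
  rw [← (cvauxEquiv k m).prod_comp, Fintype.prod_prod_type]
  rfl

lemma cvaux_perm {A B : Type*} (f g : A → B) (hf : Function.Injective f)
    (hg : Function.Injective g) (h : Set.range f = Set.range g) :
    ∃ σ : Equiv.Perm A, g = f ∘ σ := by
  refine ⟨(Equiv.ofInjective g hg).trans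
    ((Equiv.setCongr h.symm).trans (Equiv.ofInjective f hf).symm), ?_⟩
  funext a
  simp only [Function.comp, Equiv.trans_apply]
  exact (Equiv.apply_ofInjective_symm hf (Equiv.setCongr h.symm (Equiv.ofInjective g hg a))).symm

/-- Index map underlying `removeFold`. -/
def cvauxRem (k m : ℕ) (j : Fin k) : Fin (k * m - m) → Fin (k * m) :=
  removeFold k m j id

lemma cvaux_rem {Z : Type*} (k m : ℕ) (j : Fin k) (S : Fin (k * m) → Z) :
    removeFold k m j S = S ∘ cvauxRem k m j := rfl

lemma cvaux_rem_val (k m : ℕ) (j : Fin k) (i : Fin (k * m - m)) :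
    (cvauxRem k m j i : ℕ) = if (i : ℕ) < (j : ℕ) * m then (i : ℕ) else (i : ℕ) + m := rfl

lemma cvaux_rem_inj (k m : ℕ) (j : Fin k) : Function.Injective (cvauxRem k m j) := by
  intro a b h
  have h' := congrArg Fin.val h
  rw [cvaux_rem_val, cvaux_rem_val] at h'
  ext
  split_ifs at h' <;> omega

lemma cvaux_rem_range (k m : ℕ) (hm : 0 < m) (j : Fin k) :
    Set.range (cvauxRem k m j) = {x | x.divNat ≠ j} := by
  have hdiv : ∀ x : Fin (k * m), x.divNat = j ↔ (j : ℕ) * m ≤ x ∧ (x : ℕ) < (j : ℕ) * m + m := by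
    intro x
    rw [Fin.ext_iff, Fin.coe_divNat, Nat.div_eq_iff hm]
    omega
  have hjm : (j : ℕ) * m + m ≤ k * m := by
    have := Nat.mul_le_mul_right m (show (j : ℕ) + 1 ≤ k from j.2)
    linarith
  ext x
  simp only [Set.mem_range, Set.mem_ofPred_eq, ne_eq, hdiv]
  have hx := x.2
  constructor
  · rintro ⟨i, rfl⟩
    rw [cvaux_rem_val]
    split_ifs <;> omega
  · intro h
    by_cases hlt : (x : ℕ) < (j : ℕ) * m
    · refine ⟨⟨x, by omega⟩, ?_⟩
      ext
      rw [cvaux_rem_val, if_pos hlt]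
    · refine ⟨⟨x - m, by omega⟩, ?_⟩
      ext
      rw [cvaux_rem_val]
      simp only
      rw [if_neg (by omega)]
      omega

lemma cvaux_dep {Z : Type*} (k m : ℕ) (hm : 0 < m) (j : Fin k) (T T' : Fin k → Fin m → Z)
    (h : ∀ i, i ≠ j → T i = T' i) :
    removeFold k m j (cvauxGlue k m T) = removeFold k m j (cvauxGlue k m T') := by
  rw [cvaux_rem, cvaux_rem]
  funext x
  have hx : cvauxRem k m j x ∈ Set.range (cvauxRem k m j) := ⟨x, rfl⟩
  rw [cvaux_rem_range k m hm] at hx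
  simp only [Function.comp, cvauxGlue]
  rw [h _ hx]

lemma cvaux_sym {Z : Type*} (k m : ℕ) (hm : 0 < m) (i j : Fin k) (T : Fin k → Fin m → Z) :
    ∃ σ : Equiv.Perm (Fin (k * m - m)),
      removeFold k m i (cvauxGlue k m fun l => T (Equiv.swap i j l)) =
        removeFold k m j (cvauxGlue k m T) ∘ σ := by
  let τ : Equiv.Perm (Fin (k * m)) := (cvauxEquiv k m).symm.trans
    (((Equiv.swap i j).prodCongr (Equiv.refl _)).trans (cvauxEquiv k m))
  have hτ : ∀ x, τ x = foldIdx k m (Equiv.swap i j x.divNat) x.modNat := fun x => rfl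
  have e : (cvauxGlue k m fun l => T (Equiv.swap i j l)) = cvauxGlue k m T ∘ τ := by
    funext x
    simp only [Function.comp, hτ, cvaux_glue_fold]
    rfl
  obtain ⟨σ, hσ⟩ := cvaux_perm (cvauxRem k m j) (τ ∘ cvauxRem k m i) (cvaux_rem_inj k m j)
    (τ.injective.comp (cvaux_rem_inj k m i)) (by
      rw [Set.range_comp, cvaux_rem_range k m hm, cvaux_rem_range k m hm]
      ext x
      simp only [Set.mem_ofPred_eq, Set.mem_image]
      constructor
      · intro hx
        refine ⟨τ.symm x, ?_, τ.apply_symm_apply x⟩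
        intro h
        apply hx
        rw [← τ.apply_symm_apply x, hτ, (cvaux_div k m _ _).1, h, Equiv.swap_apply_left]
      · rintro ⟨y, hy, rfl⟩
        rw [hτ, (cvaux_div k m _ _).1]
        intro h
        apply hy
        exact (Equiv.swap i j).injective (h.trans (Equiv.swap_apply_left i j).symm))
  refine ⟨σ, ?_⟩
  rw [cvaux_rem, cvaux_rem, e, Function.comp_assoc, hσ, Function.comp_assoc]

lemma cvaux_avg_abs {m : ℕ} (hm : 0 < m) (f : Fin m → ℝ) (C : ℝ) (h : ∀ r, |f r| ≤ C) :
    |(1 / (m : ℝ)) * ∑ r, f r| ≤ C := by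
  have hm' : (0 : ℝ) < m := by exact_mod_cast hm
  rw [abs_mul, abs_of_pos (by positivity : (0 : ℝ) < 1 / m)]
  have : |∑ r, f r| ≤ m * C := by
    refine (Finset.abs_sum_le_sum_abs _ _).trans ?_
    refine (Finset.sum_le_sum fun j _ => h j).trans ?_
    simp
  calc 1 / (m : ℝ) * |∑ r, f r| ≤ 1 / m * (m * C) := by gcongr
    _ = C := by field_simp

lemma cvaux_avg_int {Z : Type*} [MeasurableSpace Z] (D : Measure Z) [IsProbabilityMeasure D]
    {m : ℕ} (hm : 0 < m) (f : Z → ℝ) (hf : Measurable f) (C : ℝ) (h : ∀ z, |f z| ≤ C) :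
    ∫ w : Fin m → Z, (1 / (m : ℝ)) * ∑ r, f (w r) ∂(Measure.pi fun _ => D) = ∫ z, f z ∂D := by
  have hm' : (0 : ℝ) < m := by exact_mod_cast hm
  rw [integral_const_mul, integral_finsetSum]
  · have : ∀ r : Fin m, ∫ w : Fin m → Z, f (w r) ∂(Measure.pi fun _ => D) = ∫ z, f z ∂D :=
      fun r => cvaux_integral (measurePreserving_eval (fun _ : Fin m => D) r) f hf
    simp only [this, Finset.sum_const, Finset.card_univ, Fintype.card_fin, nsmul_eq_mul]
    field_simp
  · intro r _
    exact cvaux_int (hf.comp (measurable_pi_apply r)) C fun w => h _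

lemma cvaux_main {Z : Type*} [MeasurableSpace Z] (D : Measure Z) [IsProbabilityMeasure D]
    (k m : ℕ) (hk : 0 < k) (hm : 0 < m) (M μ : ℝ) (hM : 0 ≤ M)
    (LA : (Fin (k * m) → Z) → Z → ℝ) (LR : (Fin (k * m - m) → Z) → Z → ℝ)
    (mA : Measurable fun p : (Fin (k * m) → Z) × Z => LA p.1 p.2)
    (mR : Measurable fun p : (Fin (k * m - m) → Z) × Z => LR p.1 p.2)
    (hA0 : ∀ S z, 0 ≤ LA S z) (hAM : ∀ S z, LA S z ≤ M)
    (hR0 : ∀ S z, 0 ≤ LR S z) (hRM : ∀ S z, LR S z ≤ M)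
    (hRsym : ∀ (σ : Equiv.Perm (Fin (k * m - m))) S, LR (S ∘ σ) = LR S)
    (hst : ∀ j, ∫ S, (∫ z, |LR (removeFold k m j S) z - LA S z| ∂D)
        ∂(Measure.pi fun _ : Fin (k * m) => D) ≤ μ) :
    Integrable (fun S => ((∫ z, LA S z ∂D) - (1 / ((k : ℝ) * m)) * ∑ j : Fin k, ∑ r : Fin m,
        LR (removeFold k m j S) (S (foldIdx k m j r))) ^ 2)
        (Measure.pi fun _ : Fin (k * m) => D) ∧
    ∫ S, ((∫ z, LA S z ∂D) - (1 / ((k : ℝ) * m)) * ∑ j : Fin k, ∑ r : Fin m,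
        LR (removeFold k m j S) (S (foldIdx k m j r))) ^ 2
        ∂(Measure.pi fun _ : Fin (k * m) => D) ≤ M ^ 2 / (2 * k) + 3 * M * μ := by
  have hk' : (0 : ℝ) < k := by exact_mod_cast hk
  have hm' : (0 : ℝ) < m := by exact_mod_cast hm
  have hμ : 0 ≤ μ := le_trans (integral_nonneg fun S => integral_nonneg fun z => abs_nonneg _)
    (hst ⟨0, hk⟩)
  have mrem : ∀ j, Measurable fun S : Fin (k * m) → Z => removeFold k m j S := by
    intro j
    unfold removeFold
    fun_prop
  have mRj : ∀ j, Measurable fun p : (Fin (k * m) → Z) × Z => LR (removeFold k m j p.1) p.2 :=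
    fun j => mR.comp (f := fun p : (Fin (k * m) → Z) × Z => (removeFold k m j p.1, p.2))
      (((mrem j).comp measurable_fst).prodMk measurable_snd)
  have mglue := (cvaux_mp_glue D k m).measurable
  have bA : ∀ S z, |LA S z - M / 2| ≤ M / 2 := fun S z => by
    rw [abs_le]; constructor <;> linarith [hA0 S z, hAM S z]
  have bR : ∀ S z, |LR S z - M / 2| ≤ M / 2 := fun S z => by
    rw [abs_le]; constructor <;> linarith [hR0 S z, hRM S z]
  have bD : ∀ S S' z, |LR S z - LA S' z| ≤ M := fun S S' z => by
    rw [abs_le]; constructor <;> linarith [hA0 S' z, hAM S' z, hR0 S z, hRM S z]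
  have mtot : Measurable (fun S : Fin (k * m) → Z =>
      ((∫ z, LA S z ∂D) - (1 / ((k : ℝ) * m)) * ∑ j : Fin k, ∑ r : Fin m,
        LR (removeFold k m j S) (S (foldIdx k m j r))) ^ 2) := by
    have m1 : Measurable fun S : Fin (k * m) → Z => ∫ z, LA S z ∂D :=
      (StronglyMeasurable.integral_prod_right (f := LA) mA.stronglyMeasurable).measurable
    have m2 : ∀ j r, Measurable fun S : Fin (k * m) → Z =>
        LR (removeFold k m j S) (S (foldIdx k m j r)) := fun j r =>
      (mRj j).comp (f := fun S : Fin (k * m) → Z => (S, S (foldIdx k m j r))) (by fun_prop)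
    have m3 : Measurable fun S : Fin (k * m) → Z => ∑ j : Fin k, ∑ r : Fin m,
        LR (removeFold k m j S) (S (foldIdx k m j r)) :=
      Finset.measurable_sum _ fun j _ => Finset.measurable_sum _ fun r _ => m2 j r
    exact (m1.sub (m3.const_mul _)).pow_const 2
  constructor
  · refine cvaux_int mtot (M ^ 2) fun S => ?_
    rw [abs_pow]
    have h1 : 0 ≤ ∫ z, LA S z ∂D := integral_nonneg (hA0 S)
    have h2 : ∫ z, LA S z ∂D ≤ M := by
      have := integral_mono (μ := D) (f := LA S) (g := fun _ => M)
        (cvaux_int (mA.comp (f := fun z => (S, z)) (by fun_prop)) M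
          fun z => by rw [abs_of_nonneg (hA0 S z)]; exact hAM S z)
        (integrable_const _) (hAM S)
      simpa using this
    have h3 : 0 ≤ (1 / ((k : ℝ) * m)) * ∑ j : Fin k, ∑ r : Fin m,
        LR (removeFold k m j S) (S (foldIdx k m j r)) := by
      refine mul_nonneg (by positivity) (Finset.sum_nonneg fun j _ =>
        Finset.sum_nonneg fun r _ => hR0 _ _)
    have h4 : (1 / ((k : ℝ) * m)) * ∑ j : Fin k, ∑ r : Fin m,
        LR (removeFold k m j S) (S (foldIdx k m j r)) ≤ M := by
      calc _ ≤ (1 / ((k : ℝ) * m)) * ∑ j : Fin k, ∑ r : Fin m, M := by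
            gcongr
            exact hRM _ _
        _ = M := by simp; field_simp
    refine pow_le_pow_left₀ (abs_nonneg _) ?_ 2
    rw [abs_le]
    constructor <;> linarith
  · rw [← cvaux_integral (cvaux_mp_glue D k m) _ mtot]
    have key := cvaux_moment (Measure.pi fun _ : Fin m => D) (k := k) (M / 2) μ
      (fun T w => (1 / (m : ℝ)) * ∑ r, (LA (cvauxGlue k m T) (w r) - M / 2))
      (fun j T w => (1 / (m : ℝ)) * ∑ r, (LR (removeFold k m j (cvauxGlue k m T)) (w r) - M / 2))
      hk (by positivity) hμ
      ((Finset.measurable_sum _ fun r _ => (mA.comp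
        (f := fun p : (Fin k → Fin m → Z) × (Fin m → Z) => (cvauxGlue k m p.1, p.2 r))
        (by fun_prop)).sub_const _).const_mul _)
      (fun j => (Finset.measurable_sum _ fun r _ => ((mRj j).comp
        (f := fun p : (Fin k → Fin m → Z) × (Fin m → Z) => (cvauxGlue k m p.1, p.2 r))
        (by fun_prop)).sub_const _).const_mul _)
      (fun S w => cvaux_avg_abs hm _ _ fun r => bA _ _)
      (fun j S w => cvaux_avg_abs hm _ _ fun r => bR _ _)
      (fun j T T' h => by
        simp only [cvaux_dep k m hm j T T' h])
      (fun i j T => by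
        obtain ⟨σ, hσ⟩ := cvaux_sym k m hm i j T
        simp only [hσ, hRsym])
      (fun j => by
        refine le_trans ?_ (hst j)
        have mh : Measurable fun S : Fin (k * m) → Z =>
            ∫ z, |LR (removeFold k m j S) z - LA S z| ∂D :=
          (StronglyMeasurable.integral_prod_right
            (f := fun (S : Fin (k * m) → Z) z => |LR (removeFold k m j S) z - LA S z|)
            (_root_.continuous_abs.measurable.comp ((mRj j).sub mA)).stronglyMeasurable).measurable
        rw [← cvaux_integral (cvaux_mp_glue D k m) _ mh]
        refine integral_mono_of_nonneg
          (Filter.Eventually.of_forall fun T => integral_nonneg fun w => abs_nonneg _)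
          ?_ (Filter.Eventually.of_forall fun T => ?_)
        · refine cvaux_int (mh.comp mglue) M fun T => ?_
          rw [abs_of_nonneg (integral_nonneg fun z => abs_nonneg _)]
          have := integral_mono_of_nonneg (μ := D)
            (f := fun z => |LR (removeFold k m j (cvauxGlue k m T)) z - LA (cvauxGlue k m T) z|)
            (g := fun _ => M) (Filter.Eventually.of_forall fun z => abs_nonneg _)
            (integrable_const _) (Filter.Eventually.of_forall fun z => bD _ _ z)
          simpa using this
        · have md : Measurable fun z =>
              |LR (removeFold k m j (cvauxGlue k m T)) z - LA (cvauxGlue k m T) z| :=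
            _root_.continuous_abs.measurable.comp (((mRj j).sub mA).comp
              (f := fun z => (cvauxGlue k m T, z)) (by fun_prop))
          have bd : ∀ z, |(|LR (removeFold k m j (cvauxGlue k m T)) z
              - LA (cvauxGlue k m T) z|)| ≤ M := fun z => by rw [abs_abs]; exact bD _ _ z
          simp only
          rw [← cvaux_avg_int D hm _ md M bd]
          refine integral_mono_of_nonneg (Filter.Eventually.of_forall fun w => abs_nonneg _)
            (cvaux_int ((Finset.measurable_sum _ fun r _ =>
              md.comp (measurable_pi_apply r)).const_mul _) M
              fun w => cvaux_avg_abs hm _ _ fun r => bd _)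
            (Filter.Eventually.of_forall fun w => ?_)
          simp only
          rw [← mul_sub, ← Finset.sum_sub_distrib, abs_mul,
            abs_of_pos (by positivity : (0 : ℝ) < 1 / m)]
          gcongr
          refine (Finset.abs_sum_le_sum_abs _ _).trans (le_of_eq ?_)
          refine Finset.sum_congr rfl fun r _ => ?_
          congr 1
          ring)
    have e : 2 * (M / 2) ^ 2 / k + 6 * (M / 2) * μ = M ^ 2 / (2 * k) + 3 * M * μ := by
      field_simp
      ring
    rw [e] at key
    refine le_trans (le_of_eq ?_) key
    refine integral_congr_ae (Filter.Eventually.of_forall fun T => ?_)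
    simp only
    have mLA : Measurable fun z => LA (cvauxGlue k m T) z :=
      mA.comp (f := fun z => (cvauxGlue k m T, z)) (by fun_prop)
    rw [cvaux_avg_int D hm (fun z => LA (cvauxGlue k m T) z - M / 2) (mLA.sub_const _) (M / 2)
      (bA _), integral_sub (cvaux_int mLA M fun z => by
        rw [abs_of_nonneg (hA0 _ z)]; exact hAM _ z) (integrable_const _)]
    simp only [cvaux_glue_fold, Finset.sum_sub_distrib, Finset.sum_const, Finset.card_univ,
      Fintype.card_fin, nsmul_eq_mul, ← Finset.mul_sum, integral_const, probReal_univ, smul_eq_mul]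
    congr 1
    field_simp
    ring

/-- With probability at least `1 - δ` over the draw of the i.i.d. training sample
`S ~ D^n` (with `n = k * m`), the risk of the full-sample predictor is bounded by the
`k`-fold cross-validation error plus the stability term
`sqrt((M² + 6 M k μ_h) / (2 k δ))`. -/
theorem cv_generalization_bound
    {X Y : Type*} [MeasurableSpace X] [MeasurableSpace Y]
    (D : Measure (X × Y)) [IsProbabilityMeasure D]
    (ℓ : Y → Y → ℝ) (M : ℝ)
    (hℓmeas : Measurable fun p : Y × Y => ℓ p.1 p.2)
    (hℓ0 : ∀ y y', 0 ≤ ℓ y y') (hℓM : ∀ y y', ℓ y y' ≤ M)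
    (k m : ℕ) (hk : 0 < k) (hm : 0 < m)
    (An : (Fin (k * m) → X × Y) → X → Y)
    (Ar : (Fin (k * m - m) → X × Y) → X → Y)
    (hAnsym : ∀ (σ : Equiv.Perm (Fin (k * m))) (S : Fin (k * m) → X × Y),
      An (S ∘ σ) = An S)
    (hArsym : ∀ (σ : Equiv.Perm (Fin (k * m - m))) (S : Fin (k * m - m) → X × Y),
      Ar (S ∘ σ) = Ar S)
    (hAnmeas : Measurable fun p : (Fin (k * m) → X × Y) × X => An p.1 p.2)
    (hArmeas : Measurable fun p : (Fin (k * m - m) → X × Y) × X => Ar p.1 p.2)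
    (μh : ℝ)
    (hμh : μh = ⨆ j : Fin k,
      ∫ S, (∫ z, |ℓ z.2 (Ar (removeFold k m j S) z.1) - ℓ z.2 (An S z.1)| ∂D)
        ∂(Measure.pi fun _ : Fin (k * m) => D))
    (δ : ℝ) (hδ0 : 0 < δ) (hδ1 : δ < 1) :
    ENNReal.ofReal (1 - δ) ≤
      (Measure.pi fun _ : Fin (k * m) => D)
        {S | (∫ z, ℓ z.2 (An S z.1) ∂D) ≤
            (1 / ((k : ℝ) * m)) * ∑ j : Fin k, ∑ r : Fin m,
              ℓ (S (foldIdx k m j r)).2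
                (Ar (removeFold k m j S) (S (foldIdx k m j r)).1)
          + Real.sqrt ((M ^ 2 + 6 * M * k * μh) / (2 * k * δ))} := by
  have hk' : (0 : ℝ) < k := by exact_mod_cast hk
  have hM : 0 ≤ M := by
    have : Nonempty (X × Y) := D.nonempty_of_neZero
    obtain ⟨z⟩ := this
    exact (hℓ0 z.2 z.2).trans (hℓM z.2 z.2)
  have hst : ∀ j : Fin k,
      ∫ S, (∫ z, |ℓ z.2 (Ar (removeFold k m j S) z.1) - ℓ z.2 (An S z.1)| ∂D)
        ∂(Measure.pi fun _ : Fin (k * m) => D) ≤ μh := by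
    intro j
    rw [hμh]
    exact le_ciSup (f := fun j : Fin k =>
      ∫ S, (∫ z, |ℓ z.2 (Ar (removeFold k m j S) z.1) - ℓ z.2 (An S z.1)| ∂D)
        ∂(Measure.pi fun _ : Fin (k * m) => D)) (Set.finite_range _).bddAbove j
  obtain ⟨hint, hle⟩ := cvaux_main D k m hk hm M μh hM
    (fun S z => ℓ z.2 (An S z.1)) (fun S z => ℓ z.2 (Ar S z.1))
    (hℓmeas.comp (f := fun p : (Fin (k * m) → X × Y) × (X × Y) => (p.2.2, An p.1 p.2.1))
      ((measurable_snd.comp measurable_snd).prodMk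
        (hAnmeas.comp (f := fun p : (Fin (k * m) → X × Y) × (X × Y) => (p.1, p.2.1))
          (by fun_prop))))
    (hℓmeas.comp (f := fun p : (Fin (k * m - m) → X × Y) × (X × Y) => (p.2.2, Ar p.1 p.2.1))
      ((measurable_snd.comp measurable_snd).prodMk
        (hArmeas.comp (f := fun p : (Fin (k * m - m) → X × Y) × (X × Y) => (p.1, p.2.1))
          (by fun_prop))))
    (fun _ _ => hℓ0 _ _) (fun _ _ => hℓM _ _) (fun _ _ => hℓ0 _ _) (fun _ _ => hℓM _ _)
    (fun σ S => by simp only [hArsym]) hst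
  have hμ0 : 0 ≤ μh := le_trans
    (integral_nonneg fun S => integral_nonneg fun z => abs_nonneg _) (hst ⟨0, hk⟩)
  rcases hM.eq_or_lt with hM0 | hMpos
  · have hz : ∀ y y', ℓ y y' = 0 := fun y y' =>
      le_antisymm ((hℓM y y').trans hM0.ge) (hℓ0 y y')
    have : {S : Fin (k * m) → X × Y | (∫ z, ℓ z.2 (An S z.1) ∂D) ≤
            (1 / ((k : ℝ) * m)) * ∑ j : Fin k, ∑ r : Fin m,
              ℓ (S (foldIdx k m j r)).2
                (Ar (removeFold k m j S) (S (foldIdx k m j r)).1)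
          + Real.sqrt ((M ^ 2 + 6 * M * k * μh) / (2 * k * δ))} = Set.univ := by
      refine Set.eq_univ_of_forall fun S => ?_
      simp [hz, Real.sqrt_nonneg]
    rw [this, measure_univ]
    exact ENNReal.ofReal_le_one.2 (by linarith)
  · set s := {S : Fin (k * m) → X × Y | (∫ z, ℓ z.2 (An S z.1) ∂D) ≤
            (1 / ((k : ℝ) * m)) * ∑ j : Fin k, ∑ r : Fin m,
              ℓ (S (foldIdx k m j r)).2
                (Ar (removeFold k m j S) (S (foldIdx k m j r)).1)
          + Real.sqrt ((M ^ 2 + 6 * M * k * μh) / (2 * k * δ))} with hs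
    have ht : 0 < (M ^ 2 + 6 * M * k * μh) / (2 * k * δ) := by positivity
    have hmk := mul_meas_ge_le_integral_of_nonneg
      (Filter.Eventually.of_forall fun S => sq_nonneg _) hint
      ((M ^ 2 + 6 * M * k * μh) / (2 * k * δ))
    have he : M ^ 2 / (2 * k) + 3 * M * μh = (M ^ 2 + 6 * M * k * μh) / (2 * k * δ) * δ := by
      field_simp
      ring
    have h1 := le_of_mul_le_mul_left ((hmk.trans hle).trans_eq he) ht
    have h2 : (Measure.pi fun _ : Fin (k * m) => D).real sᶜ ≤ δ := by
      refine le_trans (measureReal_mono ?_) h1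
      intro S hS
      simp only [hs, Set.mem_compl_iff, Set.mem_ofPred_eq, not_le] at hS ⊢
      rw [← Real.sq_sqrt ht.le]
      exact pow_le_pow_left₀ (Real.sqrt_nonneg _) (by linarith) 2
    have h3 : (1 : ℝ) ≤ (Measure.pi fun _ : Fin (k * m) => D).real s
        + (Measure.pi fun _ : Fin (k * m) => D).real sᶜ := by
      have := measureReal_union_le (μ := Measure.pi fun _ : Fin (k * m) => D) s sᶜ
      rwa [Set.union_compl_self, probReal_univ] at this
    refine ENNReal.ofReal_le_of_le_toReal ?_
    change 1 - δ ≤ (Measure.pi fun _ : Fin (k * m) => D).real s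
    linarith
end

section
/- The second moment of the gap between the risk and the k-fold cross-validation error satisfies E_{S∼D^n}[(R(S) − R_CV(S))²] ≤ M²/(2k) + 3·M·μ_h. -/
open MeasureTheory

lemma bdd_int {Ω : Type*} [MeasurableSpace Ω] (P : Measure Ω) [IsProbabilityMeasure P]
    {f : Ω → ℝ} (hf : Measurable f) (C : ℝ) (h : ∀ x, |f x| ≤ C) : Integrable f P :=
  Integrable.of_bound hf.aestronglyMeasurable C (Filter.Eventually.of_forall h)

lemma mul_diff_le {M a x y : ℝ} (ha0 : 0 ≤ a) (haM : a ≤ M) :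
    a * (x - y) ≤ M * max (x - y) 0 :=
  (mul_le_mul_of_nonneg_left (le_max_left _ _) ha0).trans
    (mul_le_mul_of_nonneg_right haM (le_max_right _ _))

lemma int_mul {Ω : Type*} [MeasurableSpace Ω] (P : Measure Ω) [IsProbabilityMeasure P]
    {M : ℝ} {f g : Ω → ℝ} (hf : Measurable f) (hg : Measurable g)
    (hf' : ∀ x, f x ∈ Set.Icc 0 M) (hg' : ∀ x, g x ∈ Set.Icc 0 M) :
    Integrable (fun x => f x * g x) P := by
  refine bdd_int P (hf.mul hg) (M * M) fun x => ?_
  have h1 := hf' x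
  have h2 := hg' x
  rw [abs_of_nonneg (mul_nonneg h1.1 h2.1)]
  exact mul_le_mul h1.2 h2.2 h2.1 (h1.1.trans h1.2)

lemma int_max {Ω : Type*} [MeasurableSpace Ω] (P : Measure Ω) [IsProbabilityMeasure P]
    {M : ℝ} {f g : Ω → ℝ} (hf : Measurable f) (hg : Measurable g)
    (hf' : ∀ x, f x ∈ Set.Icc 0 M) (hg' : ∀ x, g x ∈ Set.Icc 0 M) :
    Integrable (fun x => max (f x - g x) 0) P := by
  refine bdd_int P ((hf.sub hg).max measurable_const) M fun x => ?_
  have h1 := hf' x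
  have h2 := hg' x
  rw [abs_of_nonneg (le_max_right _ _)]
  exact max_le (by linarith [h1.2, h2.1]) (h1.1.trans h1.2)

lemma abs_split {Ω : Type*} [MeasurableSpace Ω] (P : Measure Ω) [IsProbabilityMeasure P]
    {M : ℝ} {f g : Ω → ℝ} (hf : Measurable f) (hg : Measurable g)
    (hf' : ∀ x, f x ∈ Set.Icc 0 M) (hg' : ∀ x, g x ∈ Set.Icc 0 M) :
    ∫ x, |f x - g x| ∂P = ∫ x, max (f x - g x) 0 ∂P + ∫ x, max (g x - f x) 0 ∂P := by
  rw [← integral_add (int_max P hf hg hf' hg') (int_max P hg hf hg' hf')]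
  congr 1
  ext x
  rcases le_total (f x) (g x) with h | h
  · rw [abs_of_nonpos (by linarith), max_eq_right (by linarith), max_eq_left (by linarith)]; ring
  · rw [abs_of_nonneg (by linarith), max_eq_left (by linarith), max_eq_right (by linarith)]; ring

lemma fsub {Ω : Type*} [MeasurableSpace Ω] {P : Measure Ω} {f g : Ω → ℝ}
    (hf : Integrable f P) (hg : Integrable g P) : Integrable (fun x => f x - g x) P :=
  hf.sub hg

lemma core_off {Ω : Type*} [MeasurableSpace Ω] (P : Measure Ω) [IsProbabilityMeasure P]
    {M μ : ℝ} (hM : 0 ≤ M) {H3 H4 Lj Ll F3 F4 h1 h2 : Ω → ℝ}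
    (mH3 : Measurable H3) (mH4 : Measurable H4) (mLj : Measurable Lj) (mLl : Measurable Ll)
    (mF3 : Measurable F3) (mF4 : Measurable F4) (mh1 : Measurable h1) (mh2 : Measurable h2)
    (bH3 : ∀ x, H3 x ∈ Set.Icc 0 M) (bH4 : ∀ x, H4 x ∈ Set.Icc 0 M)
    (bLj : ∀ x, Lj x ∈ Set.Icc 0 M) (bLl : ∀ x, Ll x ∈ Set.Icc 0 M)
    (bF3 : ∀ x, F3 x ∈ Set.Icc 0 M) (bF4 : ∀ x, F4 x ∈ Set.Icc 0 M)
    (bh1 : ∀ x, h1 x ∈ Set.Icc 0 M) (bh2 : ∀ x, h2 x ∈ Set.Icc 0 M)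
    (e1 : ∫ x, max (H4 x - F4 x) 0 ∂P = ∫ x, max (H3 x - F3 x) 0 ∂P)
    (e2 : ∫ x, F3 x * F4 x ∂P = ∫ x, Lj x * F3 x ∂P)
    (e3 : ∫ x, Lj x * H3 x ∂P = ∫ x, Lj x * H4 x ∂P)
    (e4 : ∫ x, h1 x * h2 x ∂P = ∫ x, h2 x * H3 x ∂P)
    (e5 : ∫ x, max (Lj x - h1 x) 0 ∂P = ∫ x, max (F3 x - H3 x) 0 ∂P)
    (e6 : ∫ x, |F3 x - H3 x| ∂P ≤ μ) (e7 : ∫ x, |Ll x - h2 x| ∂P ≤ μ) :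
    ∫ x, (H3 x - Lj x) * (H4 x - Ll x) ∂P ≤ 3 * M * μ := by
  have i1 := int_max P mH4 mF4 bH4 bF4
  have i2 := int_max P mH3 mF3 bH3 bF3
  have i3 := int_max P mF3 mH3 bF3 bH3
  have i4 := int_max P mLj mh1 bLj bh1
  have i5 := int_max P mLl mh2 bLl bh2
  have i6 := int_max P mh2 mLl bh2 bLl
  have p1 := int_mul P mF3 mF4 bF3 bF4
  have p2 := int_mul P mLj mF3 bLj bF3
  have p3 := int_mul P mLj mH3 bLj bH3
  have p4 := int_mul P mLj mH4 bLj bH4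
  have p5 := int_mul P mh1 mh2 bh1 bh2
  have p6 := int_mul P mh2 mH3 bh2 bH3
  rw [abs_split P mF3 mH3 bF3 bH3] at e6
  rw [abs_split P mLl mh2 bLl bh2] at e7
  have key : ∫ x, (H3 x - Lj x) * (H4 x - Ll x) ∂P ≤
      ∫ x, ((((((M * max (H4 x - F4 x) 0 + M * max (H3 x - F3 x) 0) + M * max (F3 x - H3 x) 0) +
        M * max (Lj x - h1 x) 0) + M * max (Ll x - h2 x) 0) + M * max (h2 x - Ll x) 0) +
        ((F3 x * F4 x - Lj x * F3 x) + (Lj x * H3 x - Lj x * H4 x) +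
          (h1 x * h2 x - h2 x * H3 x))) ∂P := by
    refine integral_mono (bdd_int P ((mH3.sub mLj).mul (mH4.sub mLl)) (M * M) fun x => ?_) ?_
      fun x => ?_
    · rw [abs_mul]
      refine mul_le_mul ?_ ?_ (abs_nonneg _) hM
      · exact abs_le.2 ⟨by linarith [(bH3 x).1, (bLj x).2], by linarith [(bH3 x).2, (bLj x).1]⟩
      · exact abs_le.2 ⟨by linarith [(bH4 x).1, (bLl x).2], by linarith [(bH4 x).2, (bLl x).1]⟩
    · exact ((((((i1.const_mul M).fun_add (i2.const_mul M)).fun_add (i3.const_mul M)).fun_add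
        (i4.const_mul M)).fun_add (i5.const_mul M)).fun_add (i6.const_mul M)).fun_add
        (((fsub p1 p2).fun_add (fsub p3 p4)).fun_add (fsub p5 p6))
    · have q1 := mul_diff_le (x := H4 x) (y := F4 x) (bF3 x).1 (bF3 x).2
      have q2 := mul_diff_le (x := H3 x) (y := F3 x) (bH4 x).1 (bH4 x).2
      have q3 := mul_diff_le (x := F3 x) (y := H3 x) (bLj x).1 (bLj x).2
      have q4 := mul_diff_le (x := Lj x) (y := h1 x) (bLl x).1 (bLl x).2
      have q5 := mul_diff_le (x := Ll x) (y := h2 x) (bh1 x).1 (bh1 x).2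
      have q6 := mul_diff_le (x := h2 x) (y := Ll x) (bH3 x).1 (bH3 x).2
      dsimp only
      linarith
  rw [integral_add ((((((i1.const_mul M).fun_add (i2.const_mul M)).fun_add (i3.const_mul M)).fun_add
        (i4.const_mul M)).fun_add (i5.const_mul M)).fun_add (i6.const_mul M))
        (((fsub p1 p2).fun_add (fsub p3 p4)).fun_add (fsub p5 p6)),
    integral_add (((((i1.const_mul M).fun_add (i2.const_mul M)).fun_add (i3.const_mul M)).fun_add
        (i4.const_mul M)).fun_add (i5.const_mul M)) (i6.const_mul M),
    integral_add ((((i1.const_mul M).fun_add (i2.const_mul M)).fun_add (i3.const_mul M)).fun_add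
        (i4.const_mul M)) (i5.const_mul M),
    integral_add (((i1.const_mul M).fun_add (i2.const_mul M)).fun_add (i3.const_mul M))
        (i4.const_mul M),
    integral_add ((i1.const_mul M).fun_add (i2.const_mul M)) (i3.const_mul M),
    integral_add (i1.const_mul M) (i2.const_mul M),
    integral_add ((fsub p1 p2).fun_add (fsub p3 p4)) (fsub p5 p6),
    integral_add (fsub p1 p2) (fsub p3 p4), integral_sub p1 p2, integral_sub p3 p4,
    integral_sub p5 p6, e2, e3, e4] at key
  simp only [integral_const_mul] at key
  rw [e1, e5] at key
  have := mul_le_mul_of_nonneg_left e6 hM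
  have := mul_le_mul_of_nonneg_left e7 hM
  linarith

lemma core_diag {Ω : Type*} [MeasurableSpace Ω] (P : Measure Ω) [IsProbabilityMeasure P]
    {M μ : ℝ} (hM : 0 ≤ M) {H3 H4 L F3 F4 : Ω → ℝ}
    (mH3 : Measurable H3) (mH4 : Measurable H4) (mL : Measurable L)
    (mF3 : Measurable F3) (mF4 : Measurable F4)
    (bH3 : ∀ x, H3 x ∈ Set.Icc 0 M) (bH4 : ∀ x, H4 x ∈ Set.Icc 0 M)
    (bL : ∀ x, L x ∈ Set.Icc 0 M)
    (bF3 : ∀ x, F3 x ∈ Set.Icc 0 M) (bF4 : ∀ x, F4 x ∈ Set.Icc 0 M)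
    (e1 : ∫ x, max (H4 x - F4 x) 0 ∂P = ∫ x, max (H3 x - F3 x) 0 ∂P)
    (e2 : ∫ x, F3 x * F4 x ∂P = ∫ x, L x * F3 x ∂P)
    (e3 : ∫ x, L x * H3 x ∂P = ∫ x, L x * H4 x ∂P)
    (e4 : ∫ x, L x * L x ∂P = ∫ x, F3 x * F3 x ∂P)
    (e5 : ∫ x, F4 x * F4 x ∂P = ∫ x, F3 x * F3 x ∂P)
    (e6 : ∫ x, |F3 x - H3 x| ∂P ≤ μ) :
    ∫ x, (H3 x - L x) * (H4 x - L x) ∂P ≤ M ^ 2 / 2 + 3 * M * μ := by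
  have i1 := int_max P mH4 mF4 bH4 bF4
  have i2 := int_max P mH3 mF3 bH3 bF3
  have i3 := int_max P mF3 mH3 bF3 bH3
  have p1 := int_mul P mF3 mF4 bF3 bF4
  have p2 := int_mul P mL mF3 bL bF3
  have p3 := int_mul P mL mH3 bL bH3
  have p4 := int_mul P mL mH4 bL bH4
  have p5 := int_mul P mL mL bL bL
  have p6 := int_mul P mF3 mF3 bF3 bF3
  have p7 := int_mul P mF4 mF4 bF4 bF4
  have hμ : 0 ≤ μ := le_trans (integral_nonneg fun _ => abs_nonneg _) e6
  rw [abs_split P mF3 mH3 bF3 bH3] at e6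
  have key : ∫ x, (H3 x - L x) * (H4 x - L x) ∂P ≤
      ∫ x, ((((M * max (H4 x - F4 x) 0 + M * max (H3 x - F3 x) 0) +
        (2 * M) * max (F3 x - H3 x) 0) + M ^ 2 / 2) +
        ((2 * (F3 x * F4 x - L x * F3 x) + (L x * H3 x - L x * H4 x)) +
          ((L x * L x - F3 x * F3 x) + (1 / 2) * (F3 x * F3 x - F4 x * F4 x)))) ∂P := by
    refine integral_mono (bdd_int P ((mH3.sub mL).mul (mH4.sub mL)) (M * M) fun x => ?_) ?_
      fun x => ?_
    · rw [abs_mul]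
      refine mul_le_mul ?_ ?_ (abs_nonneg _) hM
      · exact abs_le.2 ⟨by linarith [(bH3 x).1, (bL x).2], by linarith [(bH3 x).2, (bL x).1]⟩
      · exact abs_le.2 ⟨by linarith [(bH4 x).1, (bL x).2], by linarith [(bH4 x).2, (bL x).1]⟩
    · exact ((((i1.const_mul M).fun_add (i2.const_mul M)).fun_add (i3.const_mul (2 * M))).fun_add
        (integrable_const _)).fun_add
        ((((fsub p1 p2).const_mul 2).fun_add (fsub p3 p4)).fun_add ((fsub p5 p6).fun_add
          ((fsub p6 p7).const_mul _)))
    · have q1 := mul_diff_le (x := H4 x) (y := F4 x) (bF3 x).1 (bF3 x).2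
      have q2 := mul_diff_le (x := H3 x) (y := F3 x) (bH4 x).1 (bH4 x).2
      have q3 := mul_diff_le (x := F3 x) (y := H3 x) (bL x).1 (bL x).2
      have q4 : (F3 x - F4 x) ^ 2 ≤ M ^ 2 := sq_le_sq' (by linarith [(bF3 x).1, (bF4 x).2])
        (by linarith [(bF3 x).2, (bF4 x).1])
      dsimp only
      linarith
  rw [integral_add ((((i1.const_mul M).fun_add (i2.const_mul M)).fun_add (i3.const_mul (2 * M))).fun_add
        (integrable_const _))
        ((((fsub p1 p2).const_mul 2).fun_add (fsub p3 p4)).fun_add ((fsub p5 p6).fun_add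
          ((fsub p6 p7).const_mul _))),
    integral_add (((i1.const_mul M).fun_add (i2.const_mul M)).fun_add (i3.const_mul (2 * M)))
        (integrable_const _),
    integral_add ((i1.const_mul M).fun_add (i2.const_mul M)) (i3.const_mul (2 * M)),
    integral_add (i1.const_mul M) (i2.const_mul M),
    integral_add (((fsub p1 p2).const_mul 2).fun_add (fsub p3 p4)) ((fsub p5 p6).fun_add
          ((fsub p6 p7).const_mul _)),
    integral_add ((fsub p1 p2).const_mul 2) (fsub p3 p4),
    integral_add (fsub p5 p6) ((fsub p6 p7).const_mul _),
    integral_sub p3 p4, integral_sub p5 p6] at key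
  simp only [integral_const_mul] at key
  rw [integral_sub p1 p2, integral_sub p6 p7, e1, e2, e3, e4, e5] at key
  simp only [integral_const, probReal_univ, one_smul] at key
  have := mul_le_mul_of_nonneg_left e6 hM
  have := mul_nonneg hM hμ
  linarith

lemma perm_inv {K V : Type*} [Fintype K] [MeasurableSpace V] (ν : Measure V)
    [IsProbabilityMeasure ν] (τ : Equiv.Perm K) (G : (K → V) → ℝ) :
    ∫ ω, G (fun i => ω (τ i)) ∂(Measure.pi fun _ : K => ν) =
      ∫ ω, G ω ∂(Measure.pi fun _ : K => ν) := by
  have h := measurePreserving_arrowCongr' (fun _ : K => ν) (fun _ : K => ν) τ.symm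
    (MeasurableEquiv.refl V) (fun _ => MeasurePreserving.id ν)
  have := h.integral_comp' G
  rw [← this]
  rfl

lemma pi_sum_two {I V : Type*} [Fintype I] [MeasurableSpace V] (ν : Measure V)
    [IsProbabilityMeasure ν] :
    MeasurePreserving (fun ω : I ⊕ Fin 2 → V =>
      ((fun i => ω (.inl i)), (ω (.inr 0), ω (.inr 1))))
      (Measure.pi fun _ => ν) ((Measure.pi fun _ : I => ν).prod (ν.prod ν)) := by
  have h1 := measurePreserving_sumPiEquivProdPi (fun _ : I ⊕ Fin 2 => ν)
  have h2 := (MeasurePreserving.id (Measure.pi fun _ : I => ν)).prod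
    (measurePreserving_finTwoArrow ν)
  exact h2.comp h1

lemma abstract_cv {I V : Type*} [Fintype I] [DecidableEq I] [Nonempty I] [MeasurableSpace V]
    (ν : Measure V) [IsProbabilityMeasure ν] {M μ : ℝ} (hM : 0 ≤ M)
    (H : V → (I → V) → ℝ) (F : I → V → (I → V) → ℝ)
    (mH : Measurable fun p : V × (I → V) => H p.1 p.2)
    (mF : ∀ j, Measurable fun p : V × (I → V) => F j p.1 p.2)
    (bH : ∀ w s, H w s ∈ Set.Icc 0 M) (bF : ∀ j w s, F j w s ∈ Set.Icc 0 M)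
    (sH : ∀ (σ : Equiv.Perm I) w s, H w (fun i => s (σ i)) = H w s)
    (sF : ∀ j w s s', (∀ i, i ≠ j → s i = s' i) → F j w s = F j w s')
    (hμ : ∀ j, ∫ s, ∫ w, |F j w s - H w s| ∂ν ∂(Measure.pi fun _ : I => ν) ≤ μ) :
    ∫ s, ((∫ w, H w s ∂ν) - (1 / (Fintype.card I : ℝ)) * ∑ j, F j (s j) s) ^ 2
      ∂(Measure.pi fun _ : I => ν) ≤ M ^ 2 / (2 * Fintype.card I) + 3 * M * μ := by
  set P := Measure.pi fun _ : I ⊕ Fin 2 => ν with hP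
  set π := Measure.pi fun _ : I => ν with hπ
  have mS : Measurable fun ω : I ⊕ Fin 2 → V => (fun i => ω (.inl i) : I → V) := by fun_prop
  -- generic measurability
  have mH' : ∀ (i : I ⊕ Fin 2) (τ : Equiv.Perm (I ⊕ Fin 2)), Measurable
      fun ω : I ⊕ Fin 2 → V => H (ω i) (fun a => ω (τ (.inl a))) := fun i τ =>
    mH.comp (f := fun ω : I ⊕ Fin 2 → V => (ω i, (fun a => ω (τ (.inl a)) : I → V)) )
      (by fun_prop)
  have mF' : ∀ j (i : I ⊕ Fin 2), Measurable
      fun ω : I ⊕ Fin 2 → V => F j (ω i) (fun a => ω (.inl a)) := fun j i =>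
    (mF j).comp (f := fun ω : I ⊕ Fin 2 → V => (ω i, (fun a => ω (.inl a) : I → V)) )
      (by fun_prop)
  have stab : ∀ j, ∫ ω, |F j (ω (.inr 0)) (fun a => ω (.inl a)) -
      H (ω (.inr 0)) (fun a => ω (.inl a))| ∂P ≤ μ := by
    intro j
    refine le_trans (le_of_eq ?_) (hμ j)
    have mg : Measurable fun p : (I → V) × V × V => |F j p.2.1 p.1 - H p.2.1 p.1| := by
      have h1 := (mF j).comp (f := fun p : (I → V) × V × V => (p.2.1, p.1)) (by fun_prop)
      have h2 := mH.comp (f := fun p : (I → V) × V × V => (p.2.1, p.1)) (by fun_prop)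
      exact (h1.sub h2).abs
    have hb : ∀ w s, |F j w s - H w s| ≤ M := fun w s => abs_le.2
      ⟨by linarith [(bF j w s).1, (bH w s).2], by linarith [(bF j w s).2, (bH w s).1]⟩
    have h := (pi_sum_two (I := I) ν).map_eq
    have h' := integral_map (μ := P) (pi_sum_two (I := I) ν).measurable.aemeasurable
      (f := fun p : (I → V) × V × V => |F j p.2.1 p.1 - H p.2.1 p.1|)
      mg.aestronglyMeasurable
    rw [h] at h'
    rw [← h', integral_prod _ (bdd_int _ mg M (fun x => by rw [abs_abs]; exact hb _ _))]
    congr 1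
    ext s
    have := integral_prod_mul (μ := ν) (ν := ν) (fun w => |F j w s - H w s|) (fun _ => (1:ℝ))
    simpa using this
  have trans : ∀ j l, ∫ s, ((∫ w, H w s ∂ν) - F j (s j) s) * ((∫ w, H w s ∂ν) - F l (s l) s) ∂π
      = ∫ ω, (H (ω (.inr 0)) (fun a => ω (.inl a)) - F j (ω (.inl j)) (fun a => ω (.inl a))) *
        (H (ω (.inr 1)) (fun a => ω (.inl a)) - F l (ω (.inl l)) (fun a => ω (.inl a))) ∂P := by
    intro j l
    have mg : Measurable fun p : (I → V) × V × V => (H p.2.1 p.1 - F j (p.1 j) p.1) *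
        (H p.2.2 p.1 - F l (p.1 l) p.1) := by
      have h1 := (mF j).comp (f := fun p : (I → V) × V × V => (p.1 j, p.1)) (by fun_prop)
      have h2 := (mF l).comp (f := fun p : (I → V) × V × V => (p.1 l, p.1)) (by fun_prop)
      have h3 := mH.comp (f := fun p : (I → V) × V × V => (p.2.1, p.1)) (by fun_prop)
      have h4 := mH.comp (f := fun p : (I → V) × V × V => (p.2.2, p.1)) (by fun_prop)
      exact (h3.sub h1).mul (h4.sub h2)
    have hb : ∀ j v w s, |H w s - F j v s| ≤ M := fun j v w s => abs_le.2
      ⟨by linarith [(bF j v s).2, (bH w s).1], by linarith [(bF j v s).1, (bH w s).2]⟩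
    have h := (pi_sum_two (I := I) ν).map_eq
    have h' := integral_map (μ := P) (pi_sum_two (I := I) ν).measurable.aemeasurable
      (f := fun p : (I → V) × V × V => (H p.2.1 p.1 - F j (p.1 j) p.1) *
        (H p.2.2 p.1 - F l (p.1 l) p.1))
      mg.aestronglyMeasurable
    rw [h] at h'
    rw [← h', integral_prod _ (bdd_int _ mg (M * M) (fun x => by
      rw [abs_mul]; exact mul_le_mul (hb _ _ _ _) (hb _ _ _ _) (abs_nonneg _) hM))]
    congr 1
    ext s
    have := integral_prod_mul (μ := ν) (ν := ν) (fun w => H w s - F j (s j) s)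
      (fun w => H w s - F l (s l) s)
    have iH : Integrable (fun w => H w s) ν := bdd_int ν
      (mH.comp (f := fun w => (w, s)) (by fun_prop)) M
      (fun w => abs_le.2 ⟨by linarith [(bH w s).1], (bH w s).2⟩)
    simp only at this ⊢
    rw [this, integral_sub iH (integrable_const _), integral_sub iH (integrable_const _)]
    simp
  have bnd : ∀ j l, ∫ s, ((∫ w, H w s ∂ν) - F j (s j) s) * ((∫ w, H w s ∂ν) - F l (s l) s) ∂π
      ≤ (if j = l then M ^ 2 / 2 else 0) + 3 * M * μ := by
    intro j l
    rw [trans]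
    have mH3 := mH' (.inr 0) 1
    have mH4 := mH' (.inr 1) 1
    have mF3 := mF' j (.inr 0)
    have mF4 := mF' j (.inr 1)
    have mL := mF' j (.inl j)
    have mL2 := mF' l (.inl l)
    simp only [Equiv.Perm.coe_one, id_eq] at mH3 mH4
    -- swapping the fold `j` and a test fold
    have sw : ∀ (c : Fin 2) (ω : I ⊕ Fin 2 → V) w, F j w (fun a => ω (Equiv.swap (.inl j) (.inr c) (.inl a))) =
        F j w (fun a => ω (.inl a)) := by
      intro c ω w
      apply sF
      intro i hi
      rw [Equiv.swap_apply_of_ne_of_ne (by simpa using hi) (by simp)]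
    have e1 : ∫ ω, max (H (ω (.inr 1)) (fun a => ω (.inl a)) - F j (ω (.inr 1)) (fun a => ω (.inl a))) 0 ∂P
        = ∫ ω, max (H (ω (.inr 0)) (fun a => ω (.inl a)) - F j (ω (.inr 0)) (fun a => ω (.inl a))) 0 ∂P := by
      rw [← perm_inv ν (Equiv.swap (.inr 0) (.inr 1))]
      simp [Equiv.swap_apply_of_ne_of_ne, hP]
    have e2 : ∫ ω, F j (ω (.inr 0)) (fun a => ω (.inl a)) * F j (ω (.inr 1)) (fun a => ω (.inl a)) ∂P
        = ∫ ω, F j (ω (.inl j)) (fun a => ω (.inl a)) * F j (ω (.inr 0)) (fun a => ω (.inl a)) ∂P := by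
      rw [← perm_inv ν (Equiv.swap (.inl j) (.inr 1))]
      simp only [sw, Equiv.swap_apply_right]
      rw [Equiv.swap_apply_of_ne_of_ne (by simp) (by simp)]
      simp only [mul_comm, hP]
    have e3 : ∫ ω, F j (ω (.inl j)) (fun a => ω (.inl a)) * H (ω (.inr 0)) (fun a => ω (.inl a)) ∂P
        = ∫ ω, F j (ω (.inl j)) (fun a => ω (.inl a)) * H (ω (.inr 1)) (fun a => ω (.inl a)) ∂P := by
      rw [← perm_inv ν (Equiv.swap (.inr 0) (.inr 1))]
      simp [Equiv.swap_apply_of_ne_of_ne, hP]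
    by_cases hjl : j = l
    · subst hjl
      rw [if_pos rfl]
      refine core_diag P hM mH3 mH4 mL mF3 mF4 (fun _ => bH _ _) (fun _ => bH _ _)
        (fun _ => bF _ _ _) (fun _ => bF _ _ _) (fun _ => bF _ _ _) e1 e2 e3 ?_ ?_ (stab j)
      · rw [← perm_inv ν (Equiv.swap (.inl j) (.inr 0))]
        simp only [sw, Equiv.swap_apply_left, hP]
      · rw [← perm_inv ν (Equiv.swap (.inr 0) (.inr 1))]
        simp [Equiv.swap_apply_of_ne_of_ne, hP]
    · rw [if_neg hjl, zero_add]
      refine core_off P hM mH3 mH4 mL mL2 mF3 mF4 (mH' (.inl j) (Equiv.swap (.inl j) (.inr 0)))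
        (mH' (.inl l) (Equiv.swap (.inl l) (.inr 0)))
        (fun _ => bH _ _) (fun _ => bH _ _)
        (fun _ => bF _ _ _) (fun _ => bF _ _ _) (fun _ => bF _ _ _) (fun _ => bF _ _ _)
        (fun _ => bH _ _) (fun _ => bH _ _) e1 e2 e3 ?_ ?_ (stab j) ?_
      · rw [← perm_inv ν (Equiv.swap (.inl j) (.inr 0))]
        congr 1
        ext ω
        rw [mul_comm]
        congr 1
        · rw [← sH (Equiv.swap j l)]
          congr 1
          · show ω (Equiv.swap (.inl j) (.inr 0) (.inl l)) = _
            rw [Equiv.swap_apply_of_ne_of_ne (by simpa using Ne.symm hjl) (by simp)]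
          · funext a
            by_cases h1 : a = j
            · subst h1
              simp [Equiv.swap_apply_def, hjl]
            · by_cases h2 : a = l
              · subst h2
                simp [Equiv.swap_apply_def, hjl]
              · simp [Equiv.swap_apply_def, h1, h2]
        · simp
      · rw [← perm_inv ν (Equiv.swap (.inl j) (.inr 0))]
        simp only [sw, Equiv.swap_apply_left, Equiv.swap_apply_self, hP]
      · refine le_trans (le_of_eq ?_) (stab l)
        rw [← perm_inv ν (Equiv.swap (.inl l) (.inr 0))]
        congr 1
        ext ω
        simp only [Equiv.swap_apply_left, Equiv.swap_apply_self]
        rw [sF l _ _ (fun a => ω (.inl a))]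
        intro i hi
        rw [Equiv.swap_apply_of_ne_of_ne (by simpa using hi) (by simp)]
  have hc : (0 : ℝ) < Fintype.card I := by exact_mod_cast Fintype.card_pos
  set c : ℝ := (Fintype.card I : ℝ) with hcdef
  have expand : ∀ s : I → V, ((∫ w, H w s ∂ν) - (1 / c) * ∑ j, F j (s j) s) ^ 2 =
      (1 / c ^ 2) * ∑ j, ∑ l, ((∫ w, H w s ∂ν) - F j (s j) s) * ((∫ w, H w s ∂ν) - F l (s l) s) := by
    intro s
    rw [← Finset.sum_mul_sum, Finset.sum_sub_distrib, Finset.sum_const, Finset.card_univ,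
      nsmul_eq_mul, ← hcdef]
    field_simp
  have mR : Measurable fun s => ∫ w, H w s ∂ν :=
    (StronglyMeasurable.integral_prod_right
      (f := fun s w => H w s) (mH.comp measurable_swap).stronglyMeasurable).measurable
  have bR : ∀ s, (∫ w, H w s ∂ν) ∈ Set.Icc 0 M := by
    intro s
    refine ⟨integral_nonneg fun w => (bH w s).1, ?_⟩
    have iH : Integrable (fun w => H w s) ν := bdd_int ν
      (mH.comp (f := fun w => (w, s)) (by fun_prop)) M
      (fun w => abs_le.2 ⟨by linarith [(bH w s).1], (bH w s).2⟩)
    have := integral_mono iH (integrable_const M) (fun w => (bH w s).2)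
    simpa using this
  have mL : ∀ j, Measurable fun s : I → V => F j (s j) s := fun j =>
    (mF j).comp (f := fun s : I → V => (s j, s)) (by fun_prop)
  have ig : ∀ j l, Integrable (fun s => ((∫ w, H w s ∂ν) - F j (s j) s) *
      ((∫ w, H w s ∂ν) - F l (s l) s)) π := by
    intro j l
    refine bdd_int π ((mR.sub (mL j)).mul (mR.sub (mL l))) (M * M) fun s => ?_
    have hb : ∀ j, |(∫ w, H w s ∂ν) - F j (s j) s| ≤ M := fun j => abs_le.2
      ⟨by linarith [(bF j (s j) s).2, (bR s).1], by linarith [(bF j (s j) s).1, (bR s).2]⟩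
    rw [abs_mul]; exact mul_le_mul (hb _) (hb _) (abs_nonneg _) hM
  simp only [expand]
  rw [integral_const_mul, integral_finsetSum _ (fun j _ => integrable_finsetSum _ (fun l _ => ig j l))]
  have : ∀ j, ∫ s, ∑ l, ((∫ w, H w s ∂ν) - F j (s j) s) * ((∫ w, H w s ∂ν) - F l (s l) s) ∂π
      ≤ M ^ 2 / 2 + c * (3 * M * μ) := by
    intro j
    rw [integral_finsetSum _ (fun l _ => ig j l)]
    refine (Finset.sum_le_sum fun l _ => bnd j l).trans (le_of_eq ?_)
    rw [Finset.sum_add_distrib]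
    simp [hcdef]
  have h2 := Finset.sum_le_sum (s := Finset.univ) fun j _ => this j
  rw [Finset.sum_const, Finset.card_univ, nsmul_eq_mul, ← hcdef] at h2
  refine (mul_le_mul_of_nonneg_left h2 (by positivity)).trans (le_of_eq ?_)
  field_simp

lemma flat_mp {Z : Type*} [MeasurableSpace Z] (D : Measure Z) [IsProbabilityMeasure D] (k m : ℕ) :
    MeasurePreserving (fun (s : Fin k → Fin m → Z) (i : Fin (k * m)) =>
      s (finProdFinEquiv.symm i).1 (finProdFinEquiv.symm i).2)
      (Measure.pi fun _ => Measure.pi fun _ => D) (Measure.pi fun _ => D) := by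
  have h1 : MeasurePreserving (MeasurableEquiv.curry (Fin k) (Fin m) Z).symm
      (Measure.pi fun _ : Fin k => Measure.pi fun _ : Fin m => D) (Measure.pi fun _ => D) := by
    refine ⟨MeasurableEquiv.measurable _, ?_⟩
    have := Measure.infinitePi_map_curry_symm (fun (_ : Fin k) (_ : Fin m) => D)
    simpa only [Measure.infinitePi_eq_pi] using this
  have h2 := measurePreserving_arrowCongr' (fun _ : Fin k × Fin m => D)
    (fun _ : Fin (k * m) => D) finProdFinEquiv
    (MeasurableEquiv.refl Z) (fun _ => MeasurePreserving.id D)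
  exact h2.comp h1

lemma flat_foldIdx (k m : ℕ) (j : Fin k) (r : Fin m) :
    finProdFinEquiv.symm (foldIdx k m j r) = (j, r) := by
  rw [Equiv.symm_apply_eq]
  ext
  simp [foldIdx, finProdFinEquiv, add_comm, mul_comm]

lemma removeFold_congr {Z : Type*} (k m : ℕ) (j : Fin k) (S S' : Fin (k * m) → Z)
    (h : ∀ i, (finProdFinEquiv.symm i : Fin k × Fin m).1 ≠ j → S i = S' i) :
    removeFold k m j S = removeFold k m j S' := by
  funext i
  apply h
  intro hj
  have h1 := congrArg Fin.val hj
  have hm : 0 < m := by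
    rcases Nat.eq_zero_or_pos m with h0 | h0
    · subst h0; exact absurd i.2 (by simp)
    · exact h0
  simp only [finProdFinEquiv, Equiv.coe_fn_symm_mk, Fin.divNat] at h1
  rw [Nat.div_eq_iff hm] at h1
  split at h1 <;> omega

lemma avg_mem {m : ℕ} (hm : 0 < m) {M : ℝ} (f : Fin m → ℝ) (h : ∀ r, f r ∈ Set.Icc 0 M) :
    (1 / (m : ℝ)) * ∑ r, f r ∈ Set.Icc 0 M := by
  have hm' : (0 : ℝ) < m := by exact_mod_cast hm
  refine ⟨mul_nonneg (by positivity) (Finset.sum_nonneg fun r _ => (h r).1), ?_⟩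
  have : ∑ r, f r ≤ ∑ _r : Fin m, M := Finset.sum_le_sum fun r _ => (h r).2
  rw [Finset.sum_const, Finset.card_univ, nsmul_eq_mul, Fintype.card_fin] at this
  rw [one_div, inv_mul_le_iff₀ hm']
  exact this

lemma int_avg {Z : Type*} [MeasurableSpace Z] (D : Measure Z) [IsProbabilityMeasure D] {m : ℕ}
    (hm : 0 < m) (g : Z → ℝ) (mg : Measurable g) (C : ℝ) (hg : ∀ z, |g z| ≤ C) :
    ∫ w : Fin m → Z, (1 / (m : ℝ)) * ∑ r, g (w r) ∂(Measure.pi fun _ => D) = ∫ z, g z ∂D := by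
  have hm' : (m : ℝ) ≠ 0 := by exact_mod_cast hm.ne'
  rw [integral_const_mul, integral_finsetSum]
  · have : ∀ r : Fin m, ∫ w : Fin m → Z, g (w r) ∂(Measure.pi fun _ => D) = ∫ z, g z ∂D := by
      intro r
      have h := measurePreserving_eval (fun _ : Fin m => D) r
      have h' := integral_map (μ := Measure.pi fun _ : Fin m => D) h.measurable.aemeasurable
        (f := g) mg.aestronglyMeasurable
      rw [h.map_eq] at h'
      exact h'.symm
    simp only [this, Finset.sum_const, Finset.card_univ, nsmul_eq_mul, Fintype.card_fin]
    field_simp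
  · intro r _
    exact bdd_int _ (mg.comp (measurable_pi_apply r)) C (fun _ => hg _)

/-- The second moment of the gap between the risk and the `k`-fold cross-validation
error satisfies `E[(R(S) - R_CV(S))²] ≤ M²/(2k) + 3 M μ_h`. -/
theorem cv_second_moment_bound
    {X Y : Type*} [MeasurableSpace X] [MeasurableSpace Y]
    (D : Measure (X × Y)) [IsProbabilityMeasure D]
    (ℓ : Y → Y → ℝ) (M : ℝ)
    (hℓmeas : Measurable fun p : Y × Y => ℓ p.1 p.2)
    (hℓ0 : ∀ y y', 0 ≤ ℓ y y') (hℓM : ∀ y y', ℓ y y' ≤ M)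
    (k m : ℕ) (hk : 0 < k) (hm : 0 < m)
    (An : (Fin (k * m) → X × Y) → X → Y)
    (Ar : (Fin (k * m - m) → X × Y) → X → Y)
    (hAnsym : ∀ (σ : Equiv.Perm (Fin (k * m))) (S : Fin (k * m) → X × Y),
      An (S ∘ σ) = An S)
    (hArsym : ∀ (σ : Equiv.Perm (Fin (k * m - m))) (S : Fin (k * m - m) → X × Y),
      Ar (S ∘ σ) = Ar S)
    (hAnmeas : Measurable fun p : (Fin (k * m) → X × Y) × X => An p.1 p.2)
    (hArmeas : Measurable fun p : (Fin (k * m - m) → X × Y) × X => Ar p.1 p.2)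
    (μh : ℝ)
    (hμh : μh = ⨆ j : Fin k,
      ∫ S, (∫ z, |ℓ z.2 (Ar (removeFold k m j S) z.1) - ℓ z.2 (An S z.1)| ∂D)
        ∂(Measure.pi fun _ : Fin (k * m) => D))
    :
    (∫ S, ((∫ z, ℓ z.2 (An S z.1) ∂D)
        - (1 / ((k : ℝ) * m)) * ∑ j : Fin k, ∑ r : Fin m,
            ℓ (S (foldIdx k m j r)).2
              (Ar (removeFold k m j S) (S (foldIdx k m j r)).1)) ^ 2
      ∂(Measure.pi fun _ : Fin (k * m) => D))
      ≤ M ^ 2 / (2 * k) + 3 * M * μh := by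
  have hM : 0 ≤ M := by
    obtain ⟨z⟩ : Nonempty (X × Y) := D.nonempty_of_neZero
    exact (hℓ0 z.2 z.2).trans (hℓM z.2 z.2)
  have : Nonempty (Fin k) := ⟨⟨0, hk⟩⟩
  have hm' : (m : ℝ) ≠ 0 := by exact_mod_cast hm.ne'
  have hk' : (k : ℝ) ≠ 0 := by exact_mod_cast hk.ne'
  have mp := flat_mp D k m
  set Φ : (Fin k → Fin m → X × Y) → Fin (k * m) → X × Y := fun s i =>
      s (finProdFinEquiv.symm i).1 (finProdFinEquiv.symm i).2 with hΦ
  have mΦ : Measurable Φ := mp.measurable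
  have mRem : ∀ j, Measurable (removeFold k m j : (Fin (k * m) → X × Y) → _) := by
    intro j
    exact measurable_pi_lambda _ fun i => measurable_pi_apply _
  have Φfold : ∀ s j r, Φ s (foldIdx k m j r) = s j r := by
    intro s j r
    simp only [hΦ, flat_foldIdx]
  -- joint measurability of the losses
  have mLn : Measurable fun p : (X × Y) × (Fin (k * m) → X × Y) =>
      ℓ p.1.2 (An p.2 p.1.1) := by
    have h1 := hAnmeas.comp
      (f := fun p : (X × Y) × (Fin (k * m) → X × Y) => (p.2, p.1.1)) (by fun_prop)
    exact hℓmeas.comp ((measurable_snd.comp measurable_fst).prodMk h1)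
  have mLr : ∀ j, Measurable fun p : (X × Y) × (Fin (k * m) → X × Y) =>
      ℓ p.1.2 (Ar (removeFold k m j p.2) p.1.1) := by
    intro j
    have h1 := hArmeas.comp
      (f := fun p : (X × Y) × (Fin (k * m) → X × Y) => (removeFold k m j p.2, p.1.1))
      (((mRem j).comp measurable_snd).prodMk (by fun_prop))
    exact hℓmeas.comp ((measurable_snd.comp measurable_fst).prodMk h1)
  have mBlock : ∀ r : Fin m, Measurable
      fun p : (Fin m → X × Y) × (Fin k → Fin m → X × Y) => (p.1 r, Φ p.2) := fun r =>
    ((measurable_pi_apply r).comp measurable_fst).prodMk (mΦ.comp measurable_snd)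
  have main := abstract_cv (I := Fin k) (Measure.pi fun _ : Fin m => D) (M := M) (μ := μh) hM
    (fun w s => (1 / (m : ℝ)) * ∑ r, ℓ (w r).2 (An (Φ s) (w r).1))
    (fun j w s => (1 / (m : ℝ)) * ∑ r, ℓ (w r).2 (Ar (removeFold k m j (Φ s)) (w r).1))
    ?_ ?_ ?_ ?_ ?_ ?_ ?_
  · rw [Fintype.card_fin] at main
    refine le_trans (le_of_eq ?_) main
    have mR : Measurable fun S : Fin (k * m) → X × Y => ∫ z, ℓ z.2 (An S z.1) ∂D :=
      (StronglyMeasurable.integral_prod_right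
        (f := fun (S : Fin (k * m) → X × Y) (z : X × Y) => ℓ z.2 (An S z.1))
        (mLn.comp measurable_swap).stronglyMeasurable).measurable
    have mG : Measurable fun S : Fin (k * m) → X × Y => ((∫ z, ℓ z.2 (An S z.1) ∂D)
        - (1 / ((k : ℝ) * m)) * ∑ j : Fin k, ∑ r : Fin m,
            ℓ (S (foldIdx k m j r)).2
              (Ar (removeFold k m j S) (S (foldIdx k m j r)).1)) ^ 2 := by
      refine (mR.sub (Measurable.const_mul (Finset.measurable_fun_sum _ fun j _ =>
        Finset.measurable_fun_sum _ fun r _ => ?_) _)).pow_const 2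
      exact (mLr j).comp (f := fun S : Fin (k * m) → X × Y => (S (foldIdx k m j r), S))
        ((measurable_pi_apply (foldIdx k m j r)).prodMk measurable_id)
    have h' := integral_map (μ := Measure.pi fun _ : Fin k => Measure.pi fun _ : Fin m => D)
      mΦ.aemeasurable mG.aestronglyMeasurable
    rw [mp.map_eq] at h'
    rw [h']
    congr 1
    funext s
    have h1 := int_avg D hm (fun z => ℓ z.2 (An (Φ s) z.1))
      (mLn.comp (f := fun z => (z, Φ s)) (by fun_prop)) M
      (fun z => by rw [abs_of_nonneg (hℓ0 _ _)]; exact hℓM _ _)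
    rw [h1]
    simp only [Φfold]
    rw [← Finset.mul_sum, ← mul_assoc]
    congr 3
    field_simp
  · exact Measurable.const_mul (Finset.measurable_fun_sum _ fun r _ => mLn.comp (mBlock r)) _
  · intro j
    exact Measurable.const_mul (Finset.measurable_fun_sum _ fun r _ => (mLr j).comp (mBlock r)) _
  · exact fun w s => avg_mem hm _ fun r => ⟨hℓ0 _ _, hℓM _ _⟩
  · exact fun j w s => avg_mem hm _ fun r => ⟨hℓ0 _ _, hℓM _ _⟩
  · intro σ w s
    have : An (Φ fun i => s (σ i)) = An (Φ s) := by
      rw [← hAnsym (finProdFinEquiv.symm.trans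
        ((Equiv.prodCongr σ (Equiv.refl (Fin m))).trans finProdFinEquiv)) (Φ s)]
      congr 1
      funext i
      simp only [hΦ, Function.comp_apply, Equiv.trans_apply, Equiv.symm_apply_apply,
        Equiv.prodCongr_apply, Prod.map_fst, Prod.map_snd, Equiv.refl_apply]
    simp only [this]
  · intro j w s s' h
    have : removeFold k m j (Φ s) = removeFold k m j (Φ s') := by
      apply removeFold_congr
      intro i hi
      simp only [hΦ]
      rw [h _ hi]
    simp only [this]
  · intro j
    set G : (Fin (k * m) → X × Y) → ℝ := fun S =>
      ∫ z, |ℓ z.2 (Ar (removeFold k m j S) z.1) - ℓ z.2 (An S z.1)| ∂D with hG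
    have mA : Measurable fun p : (X × Y) × (Fin (k * m) → X × Y) =>
        |ℓ p.1.2 (Ar (removeFold k m j p.2) p.1.1) - ℓ p.1.2 (An p.2 p.1.1)| :=
      ((mLr j).sub mLn).abs
    have bA : ∀ (z : X × Y) S, |ℓ z.2 (Ar (removeFold k m j S) z.1) - ℓ z.2 (An S z.1)| ≤ M :=
      fun z S => abs_le.2 ⟨by linarith [hℓ0 z.2 (Ar (removeFold k m j S) z.1), hℓM z.2 (An S z.1)],
        by linarith [hℓM z.2 (Ar (removeFold k m j S) z.1), hℓ0 z.2 (An S z.1)]⟩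
    have mG : Measurable G :=
      (StronglyMeasurable.integral_prod_right
        (f := fun (S : Fin (k * m) → X × Y) (z : X × Y) =>
          |ℓ z.2 (Ar (removeFold k m j S) z.1) - ℓ z.2 (An S z.1)|)
        (mA.comp measurable_swap).stronglyMeasurable).measurable
    have h' := integral_map (μ := Measure.pi fun _ : Fin k => Measure.pi fun _ : Fin m => D)
      mΦ.aemeasurable mG.aestronglyMeasurable
    rw [mp.map_eq] at h'
    have hle : ∫ S, G S ∂(Measure.pi fun _ : Fin (k * m) => D) ≤ μh := by
      rw [hμh]
      exact le_ciSup (f := fun j : Fin k =>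
        ∫ S, (∫ z, |ℓ z.2 (Ar (removeFold k m j S) z.1) - ℓ z.2 (An S z.1)| ∂D)
        ∂(Measure.pi fun _ : Fin (k * m) => D)) (Set.finite_range _).bddAbove j
    refine le_trans ?_ hle
    rw [h']
    have bG : ∀ S, |G S| ≤ M := by
      intro S
      rw [abs_of_nonneg (integral_nonneg fun _ => abs_nonneg _)]
      have hz : Integrable (fun z : X × Y =>
          |ℓ z.2 (Ar (removeFold k m j S) z.1) - ℓ z.2 (An S z.1)|) D :=
        bdd_int D (mA.comp (f := fun z => (z, S)) (by fun_prop)) M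
          (fun z => by rw [abs_abs]; exact bA z S)
      have := integral_mono hz (integrable_const M) (fun z => bA z S)
      simpa using this
    refine integral_mono_of_nonneg (Filter.Eventually.of_forall fun s =>
      integral_nonneg fun _ => abs_nonneg _) (bdd_int _ (mG.comp mΦ) M fun s => bG _)
      (Filter.Eventually.of_forall fun s => ?_)
    have mz : Measurable fun z : X × Y =>
        |ℓ z.2 (Ar (removeFold k m j (Φ s)) z.1) - ℓ z.2 (An (Φ s) z.1)| :=
      mA.comp (f := fun z => (z, Φ s)) (by fun_prop)
    have h1 := int_avg D hm (fun z : X × Y =>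
        |ℓ z.2 (Ar (removeFold k m j (Φ s)) z.1) - ℓ z.2 (An (Φ s) z.1)|) mz M
        (fun z => by rw [abs_abs]; exact bA z _)
    simp only [hG]
    rw [← h1]
    refine integral_mono_of_nonneg (Filter.Eventually.of_forall fun w => abs_nonneg _) ?_
      (Filter.Eventually.of_forall fun w => ?_)
    · refine bdd_int _ (Measurable.const_mul (Finset.measurable_fun_sum _ fun r _ =>
        mz.comp (measurable_pi_apply r)) _) M fun w => ?_
      have := avg_mem hm (M := M) (fun r => |ℓ (w r).2 (Ar (removeFold k m j (Φ s)) (w r).1) -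
        ℓ (w r).2 (An (Φ s) (w r).1)|) (fun r => ⟨abs_nonneg _, bA _ _⟩)
      rw [abs_of_nonneg this.1]
      exact this.2
    · simp only
      rw [← mul_sub, ← Finset.sum_sub_distrib, abs_mul, abs_of_nonneg (by positivity)]
      exact mul_le_mul_of_nonneg_left (Finset.abs_sum_le_sum_abs _ _) (by positivity)
end
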